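/- Let A, B, D be C*-algebras, with A and B separable, and let π_+, π_− : M(B) → M(D) be *-homomorphisms with π_+(b) − π_−(b) ∈ D for every b ∈ B. Let ψ : A → M₂(M(B)) be an equi-continuous asymptotic homomorphism whose off-diagonal entries ψ^t_{12}(a), ψ^t_{21}(a) lie in B and with ψ_t(a) − ψ_1(a) ∈ M₂(B) for all t, a. Assume there is an asymptotic homomorphism θ = (θ_t) : A → M(B) such that ψ^t_{11}(a) − θ_t(a) ∈ B for all t ∈ [1,∞) and a ∈ A. Let V₁, V₂ ∈ M(D) be isometries with V₁V₁* + V₂V₂* = 1 and let Θ : M₂(M(D)) → M(D) be the *-isomorphism Θ([[a,b],[c,d]]) = V₁aV₁* + V₁bV₂* + V₂cV₁* + V₂dV₂*. Then there exist asymptotic homomorphisms μ, ν : A → M(D) and isometries W₁, W₂ ∈ M(D) with W₁W₁* + W₂W₂* = 1 such that W₁·Θ((π_± × ψ)_t(a))·W₁* + W₂·μ_t(a)·W₂* − ν_t(a) ∈ D for all t ∈ [1,∞) and a ∈ A, where (π_± × ψ)_t(a) denotes the matrix [[π_+(ψ^t_{11}(a)), π_+(ψ^t_{12}(a))], [π_+(ψ^t_{21}(a)),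 π_−(ψ^t_{22}(a))]]. -/

import Mathlib

open Filter Topology

attribute [local instance] Matrix.normedAddCommGroup

/-- `φ = (φ_t)_{t ∈ [1,∞)} : A → B` is an asymptotic homomorphism. -/
def IsAsymptoticHom {A B : Type*} [Mul A] [Add A] [SMul ℂ A] [Star A]
    [SeminormedAddCommGroup B] [Mul B] [SMul ℂ B] [Star B] (φ : ℝ → A → B) : Prop :=
  (∀ a : A, ContinuousOn (fun t => φ t a) (Set.Ici 1)) ∧
  (∀ a b : A, Tendsto (fun t => ‖φ t a * φ t b - φ t (a * b)‖) atTop (𝓝 0)) ∧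
  (∀ (a b : A) (c : ℂ), Tendsto (fun t => ‖φ t a + c • φ t b - φ t (a + c • b)‖) atTop (𝓝 0)) ∧
  (∀ a : A, Tendsto (fun t => ‖star (φ t a) - φ t (star a)‖) atTop (𝓝 0))

/-- The `*`-isomorphism `Θ : M₂(M(D)) → M(D)` determined by a pair of isometries `V₁`, `V₂`
with `V₁V₁* + V₂V₂* = 1`. -/
def ThetaMap {MD : Type*} [CStarAlgebra MD] (V₁ V₂ : MD)
    (x : Matrix (Fin 2) (Fin 2) MD) : MD :=
  V₁ * x 0 0 * star V₁ + V₁ * x 0 1 * star V₂ + V₂ * x 1 0 * star V₁ + V₂ * x 1 1 * star V₂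

theorem CStarAlgebra.norm_one_le (M : Type*) [CStarAlgebra M] : ‖(1 : M)‖ ≤ 1 := by
  rcases subsingleton_or_nontrivial M with _ | _
  · simp [Subsingleton.elim (1 : M) 0]
  · exact CStarRing.norm_one.le

section
attribute [local instance] CStarAlgebra.spectralOrder CStarAlgebra.spectralOrderedRing

theorem TwoSidedIdeal.exists_approx_unit {M : Type*} [CStarAlgebra M] (B : TwoSidedIdeal M)
    (F : Finset M) (hF : ∀ b ∈ F, b ∈ B) {ε : ℝ} (hε : 0 < ε) :
    ∃ u ∈ B, IsSelfAdjoint u ∧ ‖u‖ ≤ 1 ∧ ∀ b ∈ F, ‖(1 - u) * b‖ ≤ ε ∧ ‖b * (1 - u)‖ ≤ ε := by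
  set h : M := ∑ b ∈ F, (b * star b + star b * b) with hh
  have hpos : ∀ b : M, 0 ≤ b * star b + star b * b := fun b =>
    add_nonneg (mul_star_self_nonneg b) (star_mul_self_nonneg b)
  have h0 : 0 ≤ h := Finset.sum_nonneg fun b _ => hpos b
  have hle : ∀ b ∈ F, b * star b + star b * b ≤ h := fun b hb =>
    Finset.single_le_sum (f := fun b : M => b * star b + star b * b) (fun b _ => hpos b) hb
  have hB : h ∈ B := sum_mem fun b hb =>
    B.add_mem (B.mul_mem_right _ _ (hF b hb)) (B.mul_mem_left _ _ (hF b hb))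
  have hsp : ∀ x ∈ spectrum ℝ h, 0 ≤ x := fun x hx => spectrum_nonneg_of_nonneg h0 hx
  have hδ : 0 < ε ^ 2 := by positivity
  have hsp' : ∀ x ∈ spectrum ℝ h, ε ^ 2 + x ≠ 0 := fun x hx => by
    have := hsp x hx
    positivity
  have hc : ContinuousOn (fun x : ℝ => (ε ^ 2 + x)⁻¹) (spectrum ℝ h) := by
    apply ContinuousOn.inv₀ (by fun_prop) hsp'
  set u : M := cfc (fun x : ℝ => x * (ε ^ 2 + x)⁻¹) h with hu
  have hcu : ContinuousOn (fun x : ℝ => x * (ε ^ 2 + x)⁻¹) (spectrum ℝ h) :=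
    continuousOn_id.mul hc
  have hsa : IsSelfAdjoint h := IsSelfAdjoint.of_nonneg h0
  have hur : 1 - u = cfc (fun x : ℝ => ε ^ 2 * (ε ^ 2 + x)⁻¹) h := by
    rw [hu, ← cfc_const_one ℝ h, ← cfc_sub (fun _ => 1) _ h continuousOn_const hcu]
    refine cfc_congr fun x hx => ?_
    have := hsp' x hx
    field_simp
    ring
  have hrsa : IsSelfAdjoint (1 - u) := by rw [hur]; exact IsSelfAdjoint.cfc
  have hcr : ContinuousOn (fun x : ℝ => ε ^ 2 * (ε ^ 2 + x)⁻¹) (spectrum ℝ h) :=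
    continuousOn_const.mul hc
  have hrhr : ‖(1 - u) * h * (1 - u)‖ ≤ ε ^ 2 := by
    have : (1 - u) * h * (1 - u) =
        cfc (fun x : ℝ => ε ^ 2 * (ε ^ 2 + x)⁻¹ * x * (ε ^ 2 * (ε ^ 2 + x)⁻¹)) h := by
      rw [cfc_mul (fun x : ℝ => ε ^ 2 * (ε ^ 2 + x)⁻¹ * x) _ h (hcr.mul continuousOn_id) hcr,
        cfc_mul _ (fun x : ℝ => x) h hcr continuousOn_id, hur]
      congr 2
      exact (cfc_id' ℝ h).symm
    rw [this]
    refine norm_cfc_le hδ.le fun x hx => ?_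
    have hx0 := hsp x hx
    rw [Real.norm_of_nonneg (by positivity)]
    have : ε ^ 2 * (ε ^ 2 + x)⁻¹ * x * (ε ^ 2 * (ε ^ 2 + x)⁻¹) =
      ε ^ 2 * ((ε ^ 2 * x) / (ε ^ 2 + x) ^ 2) := by
      field_simp
    rw [this]
    refine mul_le_of_le_one_right hδ.le ?_
    rw [div_le_one (by positivity)]
    nlinarith [mul_nonneg hδ.le hx0, sq_nonneg x, sq_nonneg (ε ^ 2)]
  have key : ∀ c : M, c * star c ≤ h → ‖(1 - u) * c‖ ≤ ε := fun c hc' => by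
    have h1 : (1 - u) * (c * star c) * (1 - u) ≤ (1 - u) * h * (1 - u) :=
      hrsa.conjugate_le_conjugate hc'
    have h2 : (1 - u) * (c * star c) * (1 - u) = ((1 - u) * c) * star ((1 - u) * c) := by
      rw [star_mul, hrsa.star_eq]; noncomm_ring
    rw [h2] at h1
    have h3 := CStarAlgebra.norm_le_norm_of_nonneg_of_le (mul_star_self_nonneg _) h1
    rw [CStarRing.norm_self_mul_star] at h3
    nlinarith [norm_nonneg ((1 - u) * c)]
  refine ⟨u, ?_, IsSelfAdjoint.cfc, ?_, fun b hb => ⟨?_, ?_⟩⟩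
  · rw [hu, cfc_mul (fun x : ℝ => x) _ h continuousOn_id hc]
    refine B.mul_mem_right _ _ ?_
    have : cfc (fun x : ℝ => x) h = h := cfc_id' ℝ h
    rwa [this]
  · refine norm_cfc_le zero_le_one fun x hx => ?_
    have hx0 := hsp x hx
    rw [Real.norm_of_nonneg (by positivity), ← div_eq_mul_inv, div_le_one (by positivity)]
    linarith
  · exact key b (le_trans (le_add_of_nonneg_right (star_mul_self_nonneg b)) (hle b hb))
  · rw [← norm_star, star_mul, hrsa.star_eq]
    refine key (star b) ?_
    rw [star_star]
    exact le_trans (le_add_of_nonneg_left (mul_star_self_nonneg b)) (hle b hb)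
end

theorem TwoSidedIdeal.real_smul_mem {M : Type*} [CStarAlgebra M] (B : TwoSidedIdeal M) (r : ℝ)
    {b : M} (hb : b ∈ B) : r • b ∈ B := by
  rw [← smul_one_mul]
  exact B.mul_mem_left _ _ hb

theorem CStarRing.norm_add_sq_le {M : Type*} [CStarAlgebra M] (y z : M) :
    ‖y + z‖ ^ 2 ≤ ‖y‖ ^ 2 + 2 * ‖star y * z‖ + ‖z‖ ^ 2 := by
  have h1 : ‖star z * y‖ = ‖star y * z‖ := by rw [← norm_star, star_mul, star_star]
  calc ‖y + z‖ ^ 2 = ‖star y * y + star y * z + star z * y + star z * z‖ := by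
        rw [sq, ← CStarRing.norm_star_mul_self, star_add]
        congr 1
        noncomm_ring
    _ ≤ ‖star y * y‖ + ‖star y * z‖ + ‖star z * y‖ + ‖star z * z‖ := norm_add₄_le
    _ = _ := by
        rw [CStarRing.norm_star_mul_self, CStarRing.norm_star_mul_self, h1]
        ring

/-- Averages of a rapidly increasing approximate unit are quasicentral: the commutators with a
fixed element are almost orthogonal, so the norms of their partial sums grow like a square root. -/
theorem TwoSidedIdeal.exists_quasicentral_sum {M : Type*} [CStarAlgebra M] (B : TwoSidedIdeal M)
    (X F : Finset M) (hF : ∀ b ∈ F, b ∈ B) {ε : ℝ} (hε : 0 < ε) (N : ℕ) :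
    ∃ S ∈ B, IsSelfAdjoint S ∧ ‖S‖ ≤ N ∧
      (∀ x ∈ X, ‖S * x - x * S‖ ^ 2 ≤ N * (2 + 4 * ‖x‖ ^ 2)) ∧
      ∀ b ∈ F, ‖((N : M) - S) * b‖ ≤ N * ε ∧ ‖b * ((N : M) - S)‖ ≤ N * ε := by
  classical
  induction N with
  | zero => exact ⟨0, B.zero_mem, .zero _, by simp, by simp, by simp⟩
  | succ N ih =>
    obtain ⟨S, hSB, hSa, hSn, hSX, hSF⟩ := ih
    set K : ℝ := 1 + ∑ x ∈ X, ‖x‖ with hK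
    have hK0 : 0 < K := by
      have : 0 ≤ ∑ x ∈ X, ‖x‖ := Finset.sum_nonneg fun _ _ => norm_nonneg _
      linarith
    have hXK : ∀ x ∈ X, 1 + ‖x‖ ≤ K := fun x hx => by
      have := Finset.single_le_sum (f := fun x : M => ‖x‖) (fun _ _ => norm_nonneg _) hx
      linarith
    have hyB : ∀ x : M, star (S * x - x * S) ∈ B := fun x => by
      rw [star_sub, star_mul, star_mul, hSa.star_eq]
      exact B.sub_mem (B.mul_mem_left _ _ hSB) (B.mul_mem_right _ _ hSB)
    set G : Finset M := F ∪ (X.image fun x => star (S * x - x * S)) ∪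
      (X.image fun x => star (S * x - x * S) * x) with hG
    have hGB : ∀ b ∈ G, b ∈ B := fun b hb => by
      simp only [hG, Finset.mem_union, Finset.mem_image] at hb
      rcases hb with (hb | ⟨x, -, rfl⟩) | ⟨x, -, rfl⟩
      · exact hF b hb
      · exact hyB x
      · exact B.mul_mem_right _ _ (hyB x)
    obtain ⟨u, huB, hua, hun, huG⟩ := B.exists_approx_unit G hGB
      (lt_min hε (inv_pos.2 hK0))
    refine ⟨S + u, B.add_mem hSB huB, hSa.add hua, ?_, fun x hx => ?_, fun b hb => ?_⟩
    · push_cast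
      exact (norm_add_le _ _).trans (add_le_add hSn hun)
    · have h1 := (huG (star (S * x - x * S)) (by
        simp only [hG, Finset.mem_union, Finset.mem_image]
        exact .inl (.inr ⟨x, hx, rfl⟩))).2.trans (min_le_right _ _)
      have h2 := (huG (star (S * x - x * S) * x) (by
        simp only [hG, Finset.mem_union, Finset.mem_image]
        exact .inr ⟨x, hx, rfl⟩)).2.trans (min_le_right _ _)
      set y := S * x - x * S with hy
      have e1 : (S + u) * x - x * (S + u) = y + (u * x - x * u) := by rw [hy]; noncomm_ring
      have e2 : star y * (u * x - x * u) = star y * x * (1 - u) - star y * (1 - u) * x := by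
        noncomm_ring
      have h3 : ‖star y * (u * x - x * u)‖ ≤ 1 := by
        rw [e2]
        calc _ ≤ ‖star y * x * (1 - u)‖ + ‖star y * (1 - u)‖ * ‖x‖ :=
              (norm_sub_le _ _).trans (add_le_add le_rfl (norm_mul_le _ _))
          _ ≤ K⁻¹ + K⁻¹ * ‖x‖ := by gcongr
          _ = K⁻¹ * (1 + ‖x‖) := by ring
          _ ≤ K⁻¹ * K := by gcongr; exact hXK x hx
          _ = 1 := inv_mul_cancel₀ hK0.ne'
      have h4 : ‖u * x - x * u‖ ≤ 2 * ‖x‖ := by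
        calc _ ≤ ‖u‖ * ‖x‖ + ‖x‖ * ‖u‖ :=
              (norm_sub_le _ _).trans (add_le_add (norm_mul_le _ _) (norm_mul_le _ _))
          _ ≤ 1 * ‖x‖ + ‖x‖ * 1 := by gcongr
          _ = _ := by ring
      have h5 := CStarRing.norm_add_sq_le y (u * x - x * u)
      have h6 := hSX x hx
      have h7 : ‖u * x - x * u‖ ^ 2 ≤ (2 * ‖x‖) ^ 2 := by gcongr
      rw [e1]
      push_cast
      linarith
    · have hb' := huG b (by
        simp only [hG, Finset.mem_union]
        exact .inl (.inl hb))
      have e : ((N + 1 : ℕ) : M) - (S + u) = (N - S) + (1 - u) := by push_cast; abel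
      rw [e, add_mul, mul_add]
      push_cast
      rw [add_one_mul]
      exact ⟨(norm_add_le _ _).trans (add_le_add (hSF b hb).1 (hb'.1.trans (min_le_left _ _))),
        (norm_add_le _ _).trans (add_le_add (hSF b hb).2 (hb'.2.trans (min_le_left _ _)))⟩

theorem TwoSidedIdeal.exists_quasicentral {M : Type*} [CStarAlgebra M] (B : TwoSidedIdeal M)
    (X F : Finset M) (hF : ∀ b ∈ F, b ∈ B) {ε : ℝ} (hε : 0 < ε) :
    ∃ s ∈ B, IsSelfAdjoint s ∧ ‖s‖ ≤ 1 ∧ (∀ x ∈ X, ‖s * x - x * s‖ < ε) ∧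
      ∀ b ∈ F, ‖(1 - s) * b‖ < ε ∧ ‖b * (1 - s)‖ < ε := by
  obtain ⟨N, hN⟩ := exists_nat_gt ((∑ x ∈ X, (2 + 4 * ‖x‖ ^ 2)) / ε ^ 2)
  have hN0 : (0 : ℝ) < N := lt_of_le_of_lt (by positivity) hN
  obtain ⟨S, hSB, hSa, hSn, hSX, hSF⟩ := B.exists_quasicentral_sum X F hF (half_pos hε) N
  have h1 : (1 : M) - (N : ℝ)⁻¹ • S = (N : ℝ)⁻¹ • ((N : M) - S) := by
    have : (N : M) = (N : ℝ) • (1 : M) := by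
      rw [Nat.cast_smul_eq_nsmul, nsmul_one]
    rw [smul_sub, this, smul_smul, inv_mul_cancel₀ hN0.ne', one_smul]
  have hnorm : ∀ m : M, ‖(N : ℝ)⁻¹ • m‖ = (N : ℝ)⁻¹ * ‖m‖ := fun m => by
    rw [norm_smul, Real.norm_of_nonneg (inv_nonneg.2 hN0.le)]
  have hhalf : (N : ℝ)⁻¹ * (N * (ε / 2)) < ε := by
    rw [inv_mul_cancel_left₀ hN0.ne']
    linarith
  refine ⟨(N : ℝ)⁻¹ • S, B.real_smul_mem _ hSB, (IsSelfAdjoint.all _).smul hSa, ?_,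
    fun x hx => ?_, fun b hb => ⟨?_, ?_⟩⟩
  · rw [hnorm, inv_mul_le_one₀ hN0]
    exact hSn
  · rw [smul_mul_assoc, mul_smul_comm, ← smul_sub, hnorm, inv_mul_lt_iff₀ hN0]
    refine lt_of_pow_lt_pow_left₀ 2 (by positivity) ((hSX x hx).trans_lt ?_)
    have := Finset.single_le_sum (f := fun x : M => 2 + 4 * ‖x‖ ^ 2)
      (fun _ _ => by positivity) hx
    rw [div_lt_iff₀ (by positivity)] at hN
    calc (N : ℝ) * (2 + 4 * ‖x‖ ^ 2) < N * (N * ε ^ 2) := by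
          gcongr
          linarith
      _ = _ := by ring
  · rw [h1, smul_mul_assoc, hnorm]
    exact (mul_le_mul_of_nonneg_left (hSF b hb).1 (by positivity)).trans_lt hhalf
  · rw [h1, mul_smul_comm, hnorm]
    exact (mul_le_mul_of_nonneg_left (hSF b hb).2 (by positivity)).trans_lt hhalf

/-- A continuous path of self-adjoint contractions in the ideal `B` that asymptotically commutes
with countably many paths and is asymptotically a unit for countably many paths in `B`. -/
theorem TwoSidedIdeal.exists_continuous_quasicentral {M ι : Type*} [Fintype ι] [CStarAlgebra M]
    (B : TwoSidedIdeal M) (X : ℕ → ℝ → M) (hX : ∀ n, Continuous (X n)) (Y : ι → ℕ → ℝ → M)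
    (hY : ∀ i n, Continuous (Y i n)) (hYB : ∀ i n t, Y i n t ∈ B) :
    ∃ s : ℝ → M, Continuous s ∧ (∀ t, s t ∈ B ∧ IsSelfAdjoint (s t) ∧ ‖s t‖ ≤ 1) ∧
      (∀ n, Tendsto (fun t => s t * X n t - X n t * s t) atTop (𝓝 0)) ∧
      ∀ i n, Tendsto (fun t => (1 - s t) * Y i n t) atTop (𝓝 0) ∧
        Tendsto (fun t => Y i n t * (1 - s t)) atTop (𝓝 0) := by
  classical
  set T : ℝ → Set M := fun t => {s | (s ∈ B ∧ IsSelfAdjoint s ∧ ‖s‖ ≤ 1) ∧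
    ∀ n : ℕ, (n : ℝ) ≤ t → ‖s * X n t - X n t * s‖ < Real.exp (-t) ∧
      ∀ i, ‖(1 - s) * Y i n t‖ < Real.exp (-t) ∧ ‖Y i n t * (1 - s)‖ < Real.exp (-t)} with hT
  have hconv : ∀ t, Convex ℝ (T t) := by
    rintro t u ⟨⟨huB, hua, hun⟩, hu⟩ v ⟨⟨hvB, hva, hvn⟩, hv⟩ a b ha hb hab
    have key : ∀ {p q : M} {ε : ℝ}, ‖p‖ < ε → ‖q‖ < ε → ‖a • p + b • q‖ < ε := by
      intro p q ε hp hq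
      simpa using convex_ball (0 : M) ε (by simpa using hp) (by simpa using hq) ha hb hab
    have h1 : 1 - (a • u + b • v) = a • (1 - u) + b • (1 - v) := by
      rw [smul_sub, smul_sub, sub_add_sub_comm, ← add_smul, hab, one_smul]
    refine ⟨⟨B.add_mem (B.real_smul_mem _ huB) (B.real_smul_mem _ hvB),
      ((IsSelfAdjoint.all _).smul hua).add ((IsSelfAdjoint.all _).smul hva), ?_⟩,
      fun n hn => ⟨?_, fun i => ⟨?_, ?_⟩⟩⟩
    · simpa using convex_closedBall (0 : M) 1 (by simpa using hun) (by simpa using hvn) ha hb hab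
    · have : (a • u + b • v) * X n t - X n t * (a • u + b • v) =
          a • (u * X n t - X n t * u) + b • (v * X n t - X n t * v) := by
        simp only [add_mul, mul_add, smul_mul_assoc, mul_smul_comm, smul_sub]
        abel
      rw [this]
      exact key (hu n hn).1 (hv n hn).1
    · rw [h1, add_mul, smul_mul_assoc, smul_mul_assoc]
      exact key ((hu n hn).2 i).1 ((hv n hn).2 i).1
    · rw [h1, mul_add, mul_smul_comm, mul_smul_comm]
      exact key ((hu n hn).2 i).2 ((hv n hn).2 i).2
  have hloc : ∀ t, ∃ c, ∀ᶠ t' in 𝓝 t, c ∈ T t' := by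
    intro t
    set R : Finset ℕ := Finset.range (⌈t⌉₊ + 1) with hR
    obtain ⟨s, hsB, hsa, hsn, hsX, hsF⟩ := B.exists_quasicentral (R.image fun n => X n t)
      ((Finset.univ ×ˢ R).image fun p : ι × ℕ => Y p.1 p.2 t)
      (by
        intro b hb
        obtain ⟨p, -, rfl⟩ := Finset.mem_image.1 hb
        exact hYB _ _ _) (Real.exp_pos (-t))
    refine ⟨s, ?_⟩
    have hexp : Continuous fun t' : ℝ => Real.exp (-t') := by fun_prop
    have h1 : ∀ᶠ t' in 𝓝 t, ∀ n ∈ R, ‖s * X n t' - X n t' * s‖ < Real.exp (-t') := by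
      rw [eventually_all_finset]
      intro n hn
      have := hX n
      exact (Continuous.tendsto (by fun_prop) t).eventually_lt (hexp.tendsto t)
        (hsX _ (Finset.mem_image_of_mem _ hn))
    have h2 : ∀ᶠ t' in 𝓝 t, ∀ p ∈ Finset.univ ×ˢ R, ‖(1 - s) * Y p.1 p.2 t'‖ < Real.exp (-t') ∧
        ‖Y p.1 p.2 t' * (1 - s)‖ < Real.exp (-t') := by
      rw [eventually_all_finset]
      intro p hp
      have := hY p.1 p.2
      have hp' := hsF _ (Finset.mem_image_of_mem (fun p : ι × ℕ => Y p.1 p.2 t) hp)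
      exact ((Continuous.tendsto (by fun_prop) t).eventually_lt (hexp.tendsto t) hp'.1).and
        ((Continuous.tendsto (by fun_prop) t).eventually_lt (hexp.tendsto t) hp'.2)
    have h3 : ∀ᶠ t' in 𝓝 t, t' < (⌈t⌉₊ : ℝ) + 1 :=
      eventually_lt_nhds (lt_of_le_of_lt (Nat.le_ceil t) (by linarith))
    filter_upwards [h1, h2, h3] with t' h1 h2 h3
    refine ⟨⟨hsB, hsa, hsn⟩, fun n hn => ?_⟩
    have hnR : n ∈ R := by
      rw [hR, Finset.mem_range]
      exact_mod_cast hn.trans_lt h3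
    exact ⟨h1 n hnR, fun i => h2 (i, n) (by simp [hnR])⟩
  obtain ⟨g, hg⟩ := exists_continuous_forall_mem_convex_of_local_const hconv hloc
  have hlim : Tendsto (fun t : ℝ => Real.exp (-t)) atTop (𝓝 0) :=
    Real.tendsto_exp_atBot.comp tendsto_neg_atTop_atBot
  refine ⟨g, g.continuous, fun t => (hg t).1, fun n => ?_, fun i n => ⟨?_, ?_⟩⟩ <;>
    refine squeeze_zero_norm' ?_ hlim <;>
    filter_upwards [eventually_ge_atTop (n : ℝ)] with t ht
  · exact ((hg t).2 n ht).1.le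
  · exact (((hg t).2 n ht).2 i).1.le
  · exact (((hg t).2 n ht).2 i).2.le

theorem NonUnitalCStarAlgebra.exists_isSelfAdjoint_add_self_sub_mul_self {A : Type*}
    [NonUnitalCStarAlgebra A] (a : A) (ha : ‖a‖ ≤ 1) :
    ∃ b : A, IsSelfAdjoint b ∧ (b + b) - b * b = star a * a := by
  have hsa : IsSelfAdjoint (star a * a) := .star_mul_self a
  have hsp : ∀ x ∈ quasispectrum ℝ (star a * a), x ≤ 1 := fun x hx => by
    have h1 := NonUnitalIsometricContinuousFunctionalCalculus.norm_quasispectrum_le _ hx hsa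
    rw [CStarRing.norm_star_mul_self] at h1
    have h2 := (Real.le_norm_self x).trans h1
    nlinarith [norm_nonneg a]
  set f : ℝ → ℝ := fun x => 1 - √(1 - x) with hf
  have hfc : ContinuousOn f (quasispectrum ℝ (star a * a)) := by
    rw [hf]
    fun_prop
  have hf0 : f 0 = 0 := by simp [hf]
  refine ⟨cfcₙ f (star a * a), IsSelfAdjoint.cfcₙ, ?_⟩
  rw [← cfcₙ_add f f (star a * a) hfc hf0 hfc hf0, ← cfcₙ_mul f f (star a * a) hfc hf0 hfc hf0,
    ← cfcₙ_sub (fun x => f x + f x) (fun x => f x * f x) (star a * a) (hfc.add hfc) (by simp [hf0])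
      (hfc.mul hfc) (by simp [hf0])]
  conv_rhs => rw [← cfcₙ_id' ℝ (star a * a)]
  refine cfcₙ_congr fun x hx => ?_
  have := Real.mul_self_sqrt (sub_nonneg.2 (hsp x hx))
  simp only [hf]
  linarith

section
attribute [local instance] CStarAlgebra.spectralOrder CStarAlgebra.spectralOrderedRing

theorem CStarAlgebra.norm_sq_le_of_star_mul_self_eq {M : Type*} [CStarAlgebra M] {x w e : M}
    (h : star x * x = w + w - w * w + e) : ‖x‖ ^ 2 ≤ 1 + ‖star w - w‖ ^ 2 + ‖e‖ := by
  have hone := CStarAlgebra.norm_one_le M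
  set g : M := (2⁻¹ : ℝ) • ((2⁻¹ : ℝ) • (star (star w - w) * (star w - w)) + e + star e) with hg
  set k : M := 1 - (2⁻¹ : ℝ) • (w + star w) with hk
  have hks : star k = k := by
    simp [hk, add_comm]
  have h' : star x * x = star w + star w - star w * star w + star e := by
    have := congrArg star h
    simpa using this
  have h2 : star x * x = 1 + g - star k * k := by
    have h3 : star x * x = (2⁻¹ : ℝ) • ((w + w - w * w + e) +
        (star w + star w - star w * star w + star e)) := by
      rw [← h, ← h', ← two_smul ℝ, smul_smul]
      norm_num
    rw [h3, hks, hg, hk]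
    simp only [star_sub, star_star, smul_add, smul_sub, mul_sub, sub_mul, mul_add, add_mul,
      smul_mul_assoc, mul_smul_comm, smul_smul, one_mul, mul_one]
    module
  have h4 : star x * x ≤ 1 + g := by
    rw [h2]
    exact sub_le_self _ (star_mul_self_nonneg k)
  have h5 := CStarAlgebra.norm_le_norm_of_nonneg_of_le (star_mul_self_nonneg x) h4
  rw [CStarRing.norm_star_mul_self] at h5
  have h6 : ‖g‖ ≤ ‖star w - w‖ ^ 2 + ‖e‖ := by
    have h7 : ‖star (star w - w) * (star w - w)‖ = ‖star w - w‖ ^ 2 := by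
      rw [CStarRing.norm_star_mul_self, sq]
    rw [hg, norm_smul]
    have h8 := norm_add₃_le (a := (2⁻¹ : ℝ) • (star (star w - w) * (star w - w))) (b := e)
      (c := star e)
    rw [norm_smul, h7, norm_star] at h8
    norm_num at h8 ⊢
    nlinarith [sq_nonneg ‖star w - w‖]
  nlinarith [norm_add_le 1 g]
end

namespace IsAsymptoticHom

variable {A M : Type*} [NonUnitalCStarAlgebra A] [CStarAlgebra M] {φ : ℝ → A → M}

theorem eventually_norm_le_two (hφ : IsAsymptoticHom φ) {a : A} (ha : ‖a‖ ≤ 1) :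
    ∀ᶠ t in atTop, ‖φ t a‖ ≤ 2 := by
  obtain ⟨-, hmul, hlin, hstar⟩ := hφ
  obtain ⟨b, hb, hba⟩ := NonUnitalCStarAlgebra.exists_isSelfAdjoint_add_self_sub_mul_self a ha
  have hη : (0 : ℝ) < 1 / 8 := by norm_num
  filter_upwards [(hmul (star a) a).eventually_lt_const hη, (hmul b b).eventually_lt_const hη,
    (hlin b b 1).eventually_lt_const hη, (hlin (b + b) (b * b) (-1)).eventually_lt_const hη,
    (hstar a).eventually_lt_const hη, (hstar b).eventually_lt_const hη] with t h1 h2 h3 h4 h5 h6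
  have hab : b + b + (-1 : ℂ) • (b * b) = star a * a := by
    rw [← hba, neg_one_smul, sub_eq_add_neg]
  rw [hab, neg_one_smul] at h4
  rw [one_smul, one_smul] at h3
  rw [hb.star_eq] at h6
  set x := φ t a
  set w := φ t b
  set e := (star x - φ t (star a)) * x + (φ t (star a) * x - φ t (star a * a))
    - (φ t (b + b) + -φ t (b * b) - φ t (star a * a)) - (w + w - φ t (b + b))
    + (w * w - φ t (b * b)) with he
  have hx : star x * x = w + w - w * w + e := by
    rw [he]
    noncomm_ring
  have hle := CStarAlgebra.norm_sq_le_of_star_mul_self_eq hx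
  have hen : ‖e‖ ≤ 1 / 8 * ‖x‖ + 1 / 8 + 1 / 8 + 1 / 8 + 1 / 8 := by
    rw [he]
    refine (norm_add_le _ _).trans (add_le_add ((norm_sub_le _ _).trans (add_le_add
      ((norm_sub_le _ _).trans (add_le_add ((norm_add_le _ _).trans (add_le_add
        ((norm_mul_le _ _).trans ?_) h1.le)) h4.le)) h3.le)) h2.le)
    gcongr
  by_contra! hcon
  nlinarith [norm_nonneg (star w - w)]

theorem tendsto_zero (hφ : IsAsymptoticHom φ) : Tendsto (fun t => φ t 0) atTop (𝓝 0) := by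
  have := hφ.2.2.1 0 0 1
  simpa using tendsto_zero_iff_norm_tendsto_zero.2 this

/-- Asymptotic homomorphisms are asymptotically Lipschitz. -/
theorem eventually_norm_sub_le (hφ : IsAsymptoticHom φ) {a a' : A} {ε : ℝ} (hε : 0 < ε)
    (h : ‖a' - a‖ ≤ ε) : ∀ᶠ t in atTop, ‖φ t a' - φ t a‖ ≤ 4 * ε := by
  set d : A := ((ε⁻¹ : ℝ) : ℂ) • (a' - a) with hd
  have hd1 : ‖d‖ ≤ 1 := by
    rw [hd, norm_smul, Complex.norm_real, Real.norm_of_nonneg (by positivity), inv_mul_le_one₀ hε]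
    exact h
  have had : a + (ε : ℂ) • d = a' := by
    rw [hd, smul_smul, ← Complex.ofReal_mul, mul_inv_cancel₀ hε.ne']
    simp
  filter_upwards [hφ.eventually_norm_le_two hd1, (hφ.2.2.1 a d ε).eventually_lt_const hε]
    with t h1 h2
  rw [had] at h2
  calc ‖φ t a' - φ t a‖ = ‖(ε : ℂ) • φ t d - (φ t a + (ε : ℂ) • φ t d - φ t a')‖ := by
        congr 1
        abel
    _ ≤ ε * ‖φ t d‖ + ε := by
        refine (norm_sub_le _ _).trans (add_le_add ?_ h2.le)
        rw [norm_smul, Complex.norm_real, Real.norm_of_nonneg hε.le]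
    _ ≤ 4 * ε := by nlinarith

theorem exists_eventually_norm_le (hφ : IsAsymptoticHom φ) (a : A) :
    ∃ K, ∀ᶠ t in atTop, ‖φ t a‖ ≤ K := by
  refine ⟨4 * (‖a‖ + 1) + 1, ?_⟩
  filter_upwards [hφ.eventually_norm_sub_le (a := 0) (a' := a) (ε := ‖a‖ + 1) (by positivity)
    (by simp), hφ.tendsto_zero.norm.eventually_lt_const (by simp : ‖(0 : M)‖ < 1)] with t h1 h2
  have := norm_le_norm_sub_add (φ t a) (φ t 0)
  linarith

theorem add_of_tendsto_zero (hφ : IsAsymptoticHom φ) {e : ℝ → A → M}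
    (hec : ∀ a, ContinuousOn (fun t => e t a) (Set.Ici 1))
    (he : ∀ a, Tendsto (fun t => e t a) atTop (𝓝 0)) :
    IsAsymptoticHom (fun t a => φ t a + e t a) := by
  have hbdd : ∀ a, IsBoundedUnder (· ≤ ·) atTop (norm ∘ fun t => φ t a) := fun a =>
    (hφ.exists_eventually_norm_le a).imp fun K hK => by simpa using hK
  refine ⟨fun a => (hφ.1 a).add (hec a), fun a b => ?_, fun a b c => ?_, fun a => ?_⟩ <;>
    rw [← tendsto_zero_iff_norm_tendsto_zero]
  · have h1 := tendsto_zero_iff_norm_tendsto_zero.2 (hφ.2.1 a b)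
    have h2 : Tendsto (fun t => φ t a * e t b) atTop (𝓝 0) :=
      isBoundedUnder_le_mul_tendsto_zero (hbdd a) (he b)
    have h3 : Tendsto (fun t => e t a * φ t b) atTop (𝓝 0) :=
      (he a).zero_mul_isBoundedUnder_le (hbdd b)
    have h4 := (((h1.add h2).add h3).add ((he a).mul (he b))).sub (he (a * b))
    simp only [mul_zero, add_zero, sub_zero] at h4
    refine h4.congr fun t => ?_
    noncomm_ring
  · have h1 := tendsto_zero_iff_norm_tendsto_zero.2 (hφ.2.2.1 a b c)
    have h4 := ((h1.add (he a)).add ((he b).const_smul c)).sub (he (a + c • b))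
    simp only [smul_zero, add_zero, sub_zero] at h4
    refine h4.congr fun t => ?_
    beta_reduce
    rw [smul_add]
    abel
  · have h1 := tendsto_zero_iff_norm_tendsto_zero.2 (hφ.2.2.2 a)
    have h4 := (h1.add (he a).star).sub (he (star a))
    simp only [star_zero, add_zero, sub_zero] at h4
    refine h4.congr fun t => ?_
    beta_reduce
    rw [star_add]
    abel

end IsAsymptoticHom

section RationalRotation

variable {M : Type*} [CStarAlgebra M]

/-- The cosine in the rational parametrization of the circle. -/
noncomputable def ratCos (s : M) : M := (1 - s * s) * Ring.inverse (1 + s * s)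

/-- The sine in the rational parametrization of the circle. -/
noncomputable def ratSin (s : M) : M := (s + s) * Ring.inverse (1 + s * s)

theorem IsSelfAdjoint.inverse_one_add_mul_self {s : M} (hs : IsSelfAdjoint s) :
    IsUnit (1 + s * s) ∧ ‖Ring.inverse (1 + s * s)‖ ≤ 1 := by
  have hne : ∀ x : ℝ, 1 + x * x ≠ 0 := fun x => by nlinarith [mul_self_nonneg x]
  have hc : ContinuousOn (fun x : ℝ => 1 + x * x) (spectrum ℝ s) := by fun_prop
  have hci : ContinuousOn (fun x : ℝ => (1 + x * x)⁻¹) (spectrum ℝ s) :=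
    hc.inv₀ fun x _ => hne x
  have h1 : cfc (fun x : ℝ => 1 + x * x) s = 1 + s * s := by
    rw [cfc_add s (fun _ : ℝ => (1 : ℝ)) (fun x => x * x) (by fun_prop) (by fun_prop),
      cfc_const_one ℝ s, cfc_mul (fun x : ℝ => x) (fun x => x) s (by fun_prop) (by fun_prop),
      cfc_id' ℝ s]
  have h2 : (1 + s * s) * cfc (fun x : ℝ => (1 + x * x)⁻¹) s = 1 := by
    rw [← h1, ← cfc_mul _ _ s hc hci, ← cfc_const_one ℝ s]
    exact cfc_congr fun x _ => mul_inv_cancel₀ (hne x)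
  have h3 : cfc (fun x : ℝ => (1 + x * x)⁻¹) s * (1 + s * s) = 1 := by
    rw [← h1, ← cfc_mul _ _ s hci hc, ← cfc_const_one ℝ s]
    exact cfc_congr fun x _ => inv_mul_cancel₀ (hne x)
  have hu : IsUnit (1 + s * s) := ⟨⟨_, _, h2, h3⟩, rfl⟩
  refine ⟨hu, ?_⟩
  have : Ring.inverse (1 + s * s) = cfc (fun x : ℝ => (1 + x * x)⁻¹) s :=
    hu.mul_left_cancel (by rw [Ring.mul_inverse_cancel _ hu, h2])
  rw [this]
  refine norm_cfc_le zero_le_one fun x _ => ?_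
  rw [Real.norm_of_nonneg (inv_nonneg.2 (by nlinarith [mul_self_nonneg x]))]
  exact inv_le_one_of_one_le₀ (by nlinarith [mul_self_nonneg x])

theorem continuous_inverse_one_add_mul_self {s : ℝ → M} (hs : Continuous s)
    (hsa : ∀ t, IsSelfAdjoint (s t)) : Continuous fun t => Ring.inverse (1 + s t * s t) := by
  refine continuous_iff_continuousAt.2 fun t => ?_
  obtain ⟨u, hu⟩ := (hsa t).inverse_one_add_mul_self.1
  have h1 : ContinuousAt Ring.inverse (1 + s t * s t) := hu ▸ NormedRing.inverse_continuousAt u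
  exact ContinuousAt.comp (f := fun t => 1 + s t * s t) h1 (by fun_prop)

theorem continuous_ratCos {s : ℝ → M} (hs : Continuous s) (hsa : ∀ t, IsSelfAdjoint (s t)) :
    Continuous fun t => ratCos (s t) :=
  (by fun_prop : Continuous fun t => 1 - s t * s t).mul (continuous_inverse_one_add_mul_self hs hsa)

theorem continuous_ratSin {s : ℝ → M} (hs : Continuous s) (hsa : ∀ t, IsSelfAdjoint (s t)) :
    Continuous fun t => ratSin (s t) :=
  (hs.add hs).mul (continuous_inverse_one_add_mul_self hs hsa)

theorem TwoSidedIdeal.ratSin_mem (B : TwoSidedIdeal M) {s : M} (hs : s ∈ B) : ratSin s ∈ B :=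
  B.mul_mem_right _ _ (B.add_mem hs hs)

variable {s : M}

theorem TwoSidedIdeal.one_sub_ratCos_mem (B : TwoSidedIdeal M) (hs : IsSelfAdjoint s)
    (hsB : s ∈ B) : 1 - ratCos s ∈ B := by
  have h1 := Ring.mul_inverse_cancel _ hs.inverse_one_add_mul_self.1
  have : 1 - ratCos s = (s * s + s * s) * Ring.inverse (1 + s * s) := by
    calc 1 - ratCos s = (1 + s * s) * Ring.inverse (1 + s * s) - ratCos s := by rw [h1]
      _ = _ := by rw [ratCos]; noncomm_ring
  rw [this]
  exact B.mul_mem_right _ _ (B.add_mem (B.mul_mem_left _ _ hsB) (B.mul_mem_left _ _ hsB))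

theorem IsSelfAdjoint.commute_inverse_one_add_mul_self (hs : IsSelfAdjoint s) :
    Commute s (Ring.inverse (1 + s * s)) := by
  have hcomm : Commute s (1 + s * s) :=
    (Commute.one_right s).add_right ((Commute.refl s).mul_right (.refl s))
  obtain ⟨u, hu⟩ := hs.inverse_one_add_mul_self.1
  rw [← hu] at hcomm ⊢
  rw [Ring.inverse_unit]
  exact hcomm.units_inv_right

theorem IsSelfAdjoint.commute_ratCos (hs : IsSelfAdjoint s) : Commute s (ratCos s) :=
  ((Commute.one_right s).sub_right ((Commute.refl s).mul_right (.refl s))).mul_right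
    hs.commute_inverse_one_add_mul_self

theorem IsSelfAdjoint.isSelfAdjoint_inverse_one_add_mul_self (hs : IsSelfAdjoint s) :
    IsSelfAdjoint (Ring.inverse (1 + s * s)) := by
  rw [IsSelfAdjoint, ← Ring.inverse_star, star_add, star_mul, hs.star_eq, star_one]

theorem IsSelfAdjoint.ratCos (hs : IsSelfAdjoint s) : IsSelfAdjoint (ratCos s) := by
  have hc := hs.commute_inverse_one_add_mul_self
  have h : Commute (1 - s * s) (Ring.inverse (1 + s * s)) :=
    (Commute.one_left _).sub_left (hc.mul_left hc)
  exact (IsSelfAdjoint.commute_iff (by simp [IsSelfAdjoint, hs.star_eq])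
    hs.isSelfAdjoint_inverse_one_add_mul_self).1 h

theorem IsSelfAdjoint.ratSin (hs : IsSelfAdjoint s) : IsSelfAdjoint (ratSin s) :=
  (IsSelfAdjoint.commute_iff (hs.add hs) hs.isSelfAdjoint_inverse_one_add_mul_self).1
    (hs.commute_inverse_one_add_mul_self.add_left hs.commute_inverse_one_add_mul_self)

theorem IsSelfAdjoint.commute_ratCos_ratSin (hs : IsSelfAdjoint s) :
    Commute (_root_.ratCos s) (_root_.ratSin s) := by
  have h := hs.commute_ratCos.symm
  have hc := hs.commute_inverse_one_add_mul_self
  refine (h.add_right h).mul_right (Commute.mul_left ?_ (.refl _))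
  exact (Commute.one_left _).sub_left (hc.mul_left hc)

theorem IsSelfAdjoint.ratCos_mul_self_add (hs : IsSelfAdjoint s) :
    _root_.ratCos s * _root_.ratCos s + _root_.ratSin s * _root_.ratSin s = 1 := by
  have hu := hs.inverse_one_add_mul_self.1
  have hc := hs.commute_inverse_one_add_mul_self
  set r := Ring.inverse (1 + s * s) with hr
  have h1 : Commute r (1 - s * s) := ((Commute.one_left _).sub_left (hc.mul_left hc)).symm
  have h2 : Commute r (s + s) := (hc.add_left hc).symm
  have e1 : _root_.ratCos s * _root_.ratCos s = (1 - s * s) * (1 - s * s) * (r * r) := by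
    rw [_root_.ratCos, ← hr, h1.mul_mul_mul_comm]
  have e2 : _root_.ratSin s * _root_.ratSin s = (s + s) * (s + s) * (r * r) := by
    rw [_root_.ratSin, ← hr, h2.mul_mul_mul_comm]
  have e3 : (1 - s * s) * (1 - s * s) + (s + s) * (s + s) = (1 + s * s) * (1 + s * s) := by
    noncomm_ring
  rw [e1, e2, ← add_mul, e3, mul_assoc, ← mul_assoc (1 + s * s) r r, hr,
    Ring.mul_inverse_cancel _ hu, one_mul, Ring.mul_inverse_cancel _ hu]

theorem IsSelfAdjoint.norm_ratCos_le (hs : IsSelfAdjoint s) (hn : ‖s‖ ≤ 1) :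
    ‖_root_.ratCos s‖ ≤ 2 := by
  have hr1 := hs.inverse_one_add_mul_self.2
  rw [_root_.ratCos, sub_mul, one_mul]
  calc _ ≤ ‖Ring.inverse (1 + s * s)‖ + ‖s‖ * ‖s‖ * ‖Ring.inverse (1 + s * s)‖ :=
        (norm_sub_le _ _).trans (add_le_add le_rfl norm_mul₃_le)
    _ ≤ 1 + 1 * 1 * 1 := by gcongr
    _ = 2 := by norm_num

theorem IsSelfAdjoint.norm_ratSin_le (hs : IsSelfAdjoint s) (hn : ‖s‖ ≤ 1) :
    ‖_root_.ratSin s‖ ≤ 2 := by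
  have hr1 := hs.inverse_one_add_mul_self.2
  rw [_root_.ratSin]
  calc _ ≤ (‖s‖ + ‖s‖) * ‖Ring.inverse (1 + s * s)‖ :=
        (norm_mul_le _ _).trans (by gcongr; exact norm_add_le _ _)
    _ ≤ (1 + 1) * 1 := by gcongr
    _ = 2 := by norm_num

theorem IsSelfAdjoint.norm_inverse_commutator_le (hs : IsSelfAdjoint s) (hn : ‖s‖ ≤ 1) (x : M) :
    ‖Ring.inverse (1 + s * s) * x - x * Ring.inverse (1 + s * s)‖ ≤ 2 * ‖s * x - x * s‖ := by
  obtain ⟨hu, hr1⟩ := hs.inverse_one_add_mul_self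
  have h1 := Ring.mul_inverse_cancel _ hu
  have h2 := Ring.inverse_mul_cancel _ hu
  set r := Ring.inverse (1 + s * s) with hr
  set y := s * x - x * s with hy
  have e : r * x - x * r = -(r * (s * y + y * s) * r) := by
    calc r * x - x * r = r * x * ((1 + s * s) * r) - r * (1 + s * s) * x * r := by
          rw [h1, h2, mul_one, one_mul]
      _ = _ := by rw [hy]; noncomm_ring
  rw [e, norm_neg]
  calc ‖r * (s * y + y * s) * r‖ ≤ ‖r‖ * ‖s * y + y * s‖ * ‖r‖ := norm_mul₃_le
    _ ≤ 1 * ‖s * y + y * s‖ * 1 := by gcongr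
    _ ≤ ‖s‖ * ‖y‖ + ‖y‖ * ‖s‖ := by
        rw [one_mul, mul_one]
        exact (norm_add_le _ _).trans (add_le_add (norm_mul_le _ _) (norm_mul_le _ _))
    _ ≤ 1 * ‖y‖ + ‖y‖ * 1 := by gcongr
    _ = 2 * ‖y‖ := by ring

theorem IsSelfAdjoint.norm_ratCos_commutator_le (hs : IsSelfAdjoint s) (hn : ‖s‖ ≤ 1) (x : M) :
    ‖_root_.ratCos s * x - x * _root_.ratCos s‖ ≤ 4 * ‖s * x - x * s‖ := by
  have h := hs.norm_inverse_commutator_le hn x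
  have h1 := Ring.mul_inverse_cancel _ hs.inverse_one_add_mul_self.1
  set r := Ring.inverse (1 + s * s) with hr
  have e : _root_.ratCos s = r + r - 1 := by
    calc _root_.ratCos s = r + r - (1 + s * s) * r := by rw [_root_.ratCos, ← hr]; noncomm_ring
      _ = _ := by rw [h1]
  have e2 : _root_.ratCos s * x - x * _root_.ratCos s = (r * x - x * r) + (r * x - x * r) := by
    rw [e]; noncomm_ring
  rw [e2]
  exact (norm_add_le _ _).trans (by linarith)

theorem IsSelfAdjoint.norm_ratSin_commutator_le (hs : IsSelfAdjoint s) (hn : ‖s‖ ≤ 1) (x : M) :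
    ‖_root_.ratSin s * x - x * _root_.ratSin s‖ ≤ 6 * ‖s * x - x * s‖ := by
  have h := hs.norm_inverse_commutator_le hn x
  have hr1 := hs.inverse_one_add_mul_self.2
  set r := Ring.inverse (1 + s * s) with hr
  have e : _root_.ratSin s * x - x * _root_.ratSin s =
      (s * (r * x - x * r) + (s * x - x * s) * r) +
        (s * (r * x - x * r) + (s * x - x * s) * r) := by
    rw [_root_.ratSin, ← hr]; noncomm_ring
  have h2 : ‖s * (r * x - x * r) + (s * x - x * s) * r‖ ≤ 3 * ‖s * x - x * s‖ := by
    calc _ ≤ ‖s‖ * ‖r * x - x * r‖ + ‖s * x - x * s‖ * ‖r‖ :=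
          (norm_add_le _ _).trans (add_le_add (norm_mul_le _ _) (norm_mul_le _ _))
      _ ≤ 1 * (2 * ‖s * x - x * s‖) + ‖s * x - x * s‖ * 1 := by gcongr
      _ = _ := by ring
  rw [e]
  exact (norm_add_le _ _).trans (by linarith)

theorem IsSelfAdjoint.exists_ratCos_eq (hs : IsSelfAdjoint s) (hn : ‖s‖ ≤ 1) :
    ∃ p : M, ‖p‖ ≤ 2 ∧ _root_.ratCos s = p * (1 - s) ∧ _root_.ratCos s = (1 - s) * p := by
  have hc := hs.commute_inverse_one_add_mul_self
  have hr1 := hs.inverse_one_add_mul_self.2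
  set r := Ring.inverse (1 + s * s) with hr
  refine ⟨(1 + s) * r, ?_, ?_, ?_⟩
  · have : (1 + s) * r = r + s * r := by noncomm_ring
    rw [this]
    calc _ ≤ ‖r‖ + ‖s‖ * ‖r‖ := (norm_add_le _ _).trans (add_le_add le_rfl (norm_mul_le _ _))
      _ ≤ 1 + 1 * 1 := by gcongr
      _ = 2 := by norm_num
  · have h : r * (1 - s) = (1 - s) * r := ((Commute.one_left r).sub_left hc).eq.symm
    rw [mul_assoc, h, _root_.ratCos, ← hr]
    noncomm_ring
  · rw [_root_.ratCos, ← hr]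
    noncomm_ring

theorem IsSelfAdjoint.exists_one_sub_ratSin_eq (hs : IsSelfAdjoint s) (hn : ‖s‖ ≤ 1) :
    ∃ p : M, ‖p‖ ≤ 2 ∧ 1 - _root_.ratSin s = p * (1 - s) ∧ 1 - _root_.ratSin s = (1 - s) * p := by
  have hc := hs.commute_inverse_one_add_mul_self
  obtain ⟨hu, hr1⟩ := hs.inverse_one_add_mul_self
  have h1 := Ring.mul_inverse_cancel _ hu
  set r := Ring.inverse (1 + s * s) with hr
  have e : 1 - _root_.ratSin s = (1 - s) * ((1 - s) * r) := by
    calc 1 - _root_.ratSin s = (1 + s * s) * r - _root_.ratSin s := by rw [h1]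
      _ = _ := by rw [_root_.ratSin, ← hr]; noncomm_ring
  refine ⟨(1 - s) * r, ?_, ?_, e⟩
  · have : (1 - s) * r = r - s * r := by noncomm_ring
    rw [this]
    calc _ ≤ ‖r‖ + ‖s‖ * ‖r‖ := (norm_sub_le _ _).trans (add_le_add le_rfl (norm_mul_le _ _))
      _ ≤ 1 + 1 * 1 := by gcongr
      _ = 2 := by norm_num
  · have h : r * (1 - s) = (1 - s) * r := ((Commute.one_left r).sub_left hc).eq.symm
    rw [e, mul_assoc, h]

end RationalRotation

/-- A path of self-adjoint contractions in `B` gives a path of rotations with entries in the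
unitization of `B`, asymptotically commuting with everything that the given path asymptotically
commutes with, and asymptotically a quarter turn where the given path is asymptotically a unit. -/
theorem TwoSidedIdeal.exists_rotation_path {M : Type*} [CStarAlgebra M]
    (B : TwoSidedIdeal M) {s : ℝ → M} (hs : Continuous s)
    (hsB : ∀ t, s t ∈ B ∧ IsSelfAdjoint (s t) ∧ ‖s t‖ ≤ 1) :
    ∃ C S : ℝ → M, Continuous C ∧ Continuous S ∧
      (∀ t, IsSelfAdjoint (C t) ∧ IsSelfAdjoint (S t) ∧ 1 - C t ∈ B ∧ S t ∈ B ∧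
        Commute (C t) (S t) ∧ C t * C t + S t * S t = 1 ∧ ‖C t‖ ≤ 2 ∧ ‖S t‖ ≤ 2) ∧
      (∀ x : ℝ → M, Tendsto (fun t => s t * x t - x t * s t) atTop (𝓝 0) →
        Tendsto (fun t => C t * x t - x t * C t) atTop (𝓝 0) ∧
        Tendsto (fun t => S t * x t - x t * S t) atTop (𝓝 0)) ∧
      (∀ y : ℝ → M, Tendsto (fun t => (1 - s t) * y t) atTop (𝓝 0) →
        Tendsto (fun t => C t * y t) atTop (𝓝 0) ∧
        Tendsto (fun t => (1 - S t) * y t) atTop (𝓝 0)) ∧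
      (∀ y : ℝ → M, Tendsto (fun t => y t * (1 - s t)) atTop (𝓝 0) →
        Tendsto (fun t => y t * C t) atTop (𝓝 0) ∧
        Tendsto (fun t => y t * (1 - S t)) atTop (𝓝 0)) := by
  have hsa := fun t => (hsB t).2.1
  have hn := fun t => (hsB t).2.2
  have hlim : ∀ {f g : ℝ → M} {K : ℝ}, (∀ t, ‖g t‖ ≤ K * ‖f t‖) → Tendsto f atTop (𝓝 0) →
      Tendsto g atTop (𝓝 0) := fun {f g K} hfg hf =>
    squeeze_zero_norm hfg (by simpa using hf.norm.const_mul K)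
  choose p hp hp1 hp2 using fun t => (hsa t).exists_ratCos_eq (hn t)
  choose q hq hq1 hq2 using fun t => (hsa t).exists_one_sub_ratSin_eq (hn t)
  have hl : ∀ u v : M, ‖u‖ ≤ 2 → ‖u * v‖ ≤ 2 * ‖v‖ := fun u v hu =>
    (norm_mul_le _ _).trans (by gcongr)
  have hr : ∀ u v : M, ‖u‖ ≤ 2 → ‖v * u‖ ≤ 2 * ‖v‖ := fun u v hu =>
    (norm_mul_le _ _).trans (by rw [mul_comm]; gcongr)
  refine ⟨fun t => ratCos (s t), fun t => ratSin (s t), continuous_ratCos hs hsa,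
    continuous_ratSin hs hsa, fun t => ⟨(hsa t).ratCos, (hsa t).ratSin,
      B.one_sub_ratCos_mem (hsa t) (hsB t).1, B.ratSin_mem (hsB t).1,
      (hsa t).commute_ratCos_ratSin, (hsa t).ratCos_mul_self_add,
      (hsa t).norm_ratCos_le (hn t), (hsa t).norm_ratSin_le (hn t)⟩,
    fun x hx => ⟨hlim (fun t => (hsa t).norm_ratCos_commutator_le (hn t) _) hx,
      hlim (fun t => (hsa t).norm_ratSin_commutator_le (hn t) _) hx⟩,
    fun y hy => ⟨hlim (K := 2) (fun t => ?_) hy, hlim (K := 2) (fun t => ?_) hy⟩,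
    fun y hy => ⟨hlim (K := 2) (fun t => ?_) hy, hlim (K := 2) (fun t => ?_) hy⟩⟩
  · beta_reduce
    rw [hp1, mul_assoc]
    exact hl _ _ (hp t)
  · beta_reduce
    rw [hq1, mul_assoc]
    exact hl _ _ (hq t)
  · beta_reduce
    rw [hp2, ← mul_assoc]
    exact hr _ _ (hp t)
  · beta_reduce
    rw [hq2, ← mul_assoc]
    exact hr _ _ (hq t)

/-- A family `f` of maps is asymptotically equicontinuous if each of its increments is eventually
small, in terms of the distance of the arguments only. -/
def AsymptoticallyEquicontinuous {A M : Type*} [SeminormedAddCommGroup A]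
    [SeminormedAddCommGroup M] (f : ℝ → A → M) : Prop :=
  ∀ a, ∀ ε > 0, ∃ δ > 0, ∀ a', ‖a' - a‖ < δ → ∀ᶠ t in atTop, ‖f t a' - f t a‖ ≤ ε

namespace AsymptoticallyEquicontinuous

variable {A M N : Type*} [SeminormedAddCommGroup A] [SeminormedAddCommGroup M]
  [SeminormedAddCommGroup N] {f g : ℝ → A → M}

theorem sub (hf : AsymptoticallyEquicontinuous f) (hg : AsymptoticallyEquicontinuous g) :
    AsymptoticallyEquicontinuous fun t a => f t a - g t a := by
  intro a ε hε
  obtain ⟨δ₁, hδ₁, h₁⟩ := hf a (ε / 2) (half_pos hε)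
  obtain ⟨δ₂, hδ₂, h₂⟩ := hg a (ε / 2) (half_pos hε)
  refine ⟨min δ₁ δ₂, lt_min hδ₁ hδ₂, fun a' ha' => ?_⟩
  filter_upwards [h₁ a' (ha'.trans_le (min_le_left _ _)),
    h₂ a' (ha'.trans_le (min_le_right _ _))] with t ht₁ ht₂
  rw [sub_sub_sub_comm]
  exact (norm_sub_le _ _).trans (by linarith)

theorem comp_lipschitz (hf : AsymptoticallyEquicontinuous f) {T : ℝ → M → N} {K : ℝ}
    (hK : 0 < K) (hT : ∀ t x y, ‖T t x - T t y‖ ≤ K * ‖x - y‖) :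
    AsymptoticallyEquicontinuous fun t a => T t (f t a) := by
  intro a ε hε
  obtain ⟨δ, hδ, h⟩ := hf a (ε / K) (div_pos hε hK)
  refine ⟨δ, hδ, fun a' ha' => ?_⟩
  filter_upwards [h a' ha'] with t ht
  calc _ ≤ K * ‖f t a' - f t a‖ := hT _ _ _
    _ ≤ K * (ε / K) := by gcongr
    _ = ε := mul_div_cancel₀ _ hK.ne'

theorem tendsto_zero_of_dense (hf : AsymptoticallyEquicontinuous f) {u : ℕ → A}
    (hu : DenseRange u) (h : ∀ n, Tendsto (fun t => f t (u n)) atTop (𝓝 0)) (a : A) :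
    Tendsto (fun t => f t a) atTop (𝓝 0) := by
  refine Metric.tendsto_nhds.2 fun ε hε => ?_
  obtain ⟨δ, hδ, hfδ⟩ := hf a (ε / 2) (half_pos hε)
  obtain ⟨n, hn⟩ := hu.exists_dist_lt a hδ
  rw [dist_comm, dist_eq_norm] at hn
  filter_upwards [hfδ _ hn, (Metric.tendsto_nhds.1 (h n)) (ε / 2) (half_pos hε)] with t h₁ h₂
  rw [dist_zero_right] at h₂ ⊢
  have := norm_le_norm_add_norm_sub (f t (u n)) (f t a)
  linarith

end AsymptoticallyEquicontinuous

theorem IsAsymptoticHom.asymptoticallyEquicontinuous {A M : Type*} [NonUnitalCStarAlgebra A]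
    [CStarAlgebra M] {φ : ℝ → A → M} (hφ : IsAsymptoticHom φ) :
    AsymptoticallyEquicontinuous φ := fun a ε hε =>
  ⟨ε / 4, by positivity, fun a' ha' => by
    simpa [mul_div_cancel₀] using hφ.eventually_norm_sub_le (by positivity) ha'.le⟩

theorem Equicontinuous.asymptoticallyEquicontinuous_apply {A M : Type*}
    [SeminormedAddCommGroup A] [NormedAddCommGroup M] {ψ : ℝ → A → Matrix (Fin 2) (Fin 2) M}
    (hψ : Equicontinuous fun t : Set.Ici (1 : ℝ) => ψ t) (i j : Fin 2) :
    AsymptoticallyEquicontinuous fun t a => ψ t a i j := by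
  intro a ε hε
  obtain ⟨δ, hδ, h⟩ := Metric.equicontinuousAt_iff.1 (hψ a) ε hε
  refine ⟨δ, hδ, fun a' ha' => ?_⟩
  filter_upwards [eventually_ge_atTop 1] with t ht
  have h1 := h a' (by rwa [dist_eq_norm]) ⟨t, ht⟩
  rw [dist_comm, dist_eq_norm] at h1
  exact (Matrix.norm_entry_le_entrywise_sup_norm (ψ t a' - ψ t a)).trans h1.le

/-- Composition of an asymptotic homomorphism with a uniformly bounded path of homomorphisms. -/
theorem IsAsymptoticHom.map {A N M : Type*} [Mul A] [Add A] [SMul ℂ A] [Star A]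
    [SeminormedAddCommGroup N] [Mul N] [SMul ℂ N] [Star N] [CStarAlgebra M]
    {φ : ℝ → A → N} (hφ : IsAsymptoticHom φ) {T : ℝ → N → M} {K : ℝ}
    (hmul : ∀ t x y, T t (x * y) = T t x * T t y) (hadd : ∀ t x y, T t (x + y) = T t x + T t y)
    (hsub : ∀ t x y, T t (x - y) = T t x - T t y)
    (hsmul : ∀ t (c : ℂ) x, T t (c • x) = c • T t x) (hstar : ∀ t x, T t (star x) = star (T t x))
    (hK : ∀ t x, ‖T t x‖ ≤ K * ‖x‖)
    (hcont : ∀ a, ContinuousOn (fun t => T t (φ t a)) (Set.Ici 1)) :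
    IsAsymptoticHom fun t a => T t (φ t a) := by
  refine ⟨hcont, fun a b => ?_, fun a b c => ?_, fun a => ?_⟩
  · simp only [← hmul, ← hsub]
    exact squeeze_zero (fun _ => norm_nonneg _) (fun t => hK t _)
      (by simpa using (hφ.2.1 a b).const_mul K)
  · simp only [← hsmul, ← hadd, ← hsub]
    exact squeeze_zero (fun _ => norm_nonneg _) (fun t => hK t _)
      (by simpa using (hφ.2.2.1 a b c).const_mul K)
  · simp only [← hstar, ← hsub]
    exact squeeze_zero (fun _ => norm_nonneg _) (fun t => hK t _)
      (by simpa using (hφ.2.2.2 a).const_mul K)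

theorem IsAsymptoticHom.add_of_orthogonal {A M : Type*} [Mul A] [Add A] [SMul ℂ A] [Star A]
    [CStarAlgebra M] {φ ψ : ℝ → A → M} (hφ : IsAsymptoticHom φ) (hψ : IsAsymptoticHom ψ)
    (h₁ : ∀ t a b, φ t a * ψ t b = 0) (h₂ : ∀ t a b, ψ t a * φ t b = 0) :
    IsAsymptoticHom fun t a => φ t a + ψ t a := by
  refine ⟨fun a => (hφ.1 a).add (hψ.1 a), fun a b => ?_, fun a b c => ?_, fun a => ?_⟩
  · refine squeeze_zero (fun _ => norm_nonneg _) (fun t => ?_)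
      (by simpa using (hφ.2.1 a b).add (hψ.2.1 a b))
    refine le_of_eq_of_le (congrArg norm ?_) (norm_add_le _ _)
    beta_reduce
    rw [add_mul, mul_add, mul_add, h₁, h₂]
    abel
  · refine squeeze_zero (fun _ => norm_nonneg _) (fun t => ?_)
      (by simpa using (hφ.2.2.1 a b c).add (hψ.2.2.1 a b c))
    refine le_of_eq_of_le (congrArg norm ?_) (norm_add_le _ _)
    beta_reduce
    rw [smul_add]
    abel
  · refine squeeze_zero (fun _ => norm_nonneg _) (fun t => ?_)
      (by simpa using (hφ.2.2.2 a).add (hψ.2.2.2 a))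
    refine le_of_eq_of_le (congrArg norm ?_) (norm_add_le _ _)
    beta_reduce
    rw [star_add]
    abel

section RotatedSum

variable {MB MD : Type*} [CStarAlgebra MB] [CStarAlgebra MD]

theorem mul_thetaMap_mul_star (W V₁ V₂ : MD) (x : Matrix (Fin 2) (Fin 2) MD) :
    W * ThetaMap V₁ V₂ x * star W = ThetaMap (W * V₁) (W * V₂) x := by
  simp only [ThetaMap, star_mul]
  noncomm_ring

/-- The sum of `πp θ` and `πm m`, supported on the frame `E₁, E₂, E₃` after rotating the plane
spanned by `E₁` and `E₃` by the rotation with entries `πm C`, `πm S` (unitally extended). -/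
noncomputable def rotatedSum (πp πm : MB →⋆ₙₐ[ℂ] MD) (E₁ E₂ E₃ : MD) (C S θ : MB)
    (m : Matrix (Fin 2) (Fin 2) MB) : MD :=
  (E₁ * (1 - πm (1 - C)) - E₃ * πm S) * πp θ * star (E₁ * (1 - πm (1 - C)) - E₃ * πm S) +
    ThetaMap (E₁ * πm S + E₃ * (1 - πm (1 - C))) E₂ (m.map πm)

/-- The correction turning `rotatedSum` into a perturbation of the unrotated sum by elements
of the ideal. -/
noncomputable def rotationCorrection (πp πm : MB →⋆ₙₐ[ℂ] MD) (E₁ E₂ E₃ : MD) (C S θ : MB)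
    (m : Matrix (Fin 2) (Fin 2) MB) : MD :=
  E₁ * πp (m 0 0 - C * θ * C - S * m 0 0 * S) * star E₁ +
    E₁ * πm (m 0 1 - S * m 0 1) * star E₂ + E₂ * πm (m 1 0 - m 1 0 * S) * star E₁ +
    E₁ * πp (C * θ * S - S * m 0 0 * C) * star E₃ +
    E₃ * πp (S * θ * C - C * m 0 0 * S) * star E₁ -
    E₂ * πm (m 1 0 * C) * star E₃ - E₃ * πm (C * m 0 1) * star E₂ +
    E₃ * πm (θ - S * θ * S - C * m 0 0 * C) * star E₃

theorem thetaMap_add_sub_rotatedSum_mem {B : TwoSidedIdeal MB} {D : TwoSidedIdeal MD}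
    {πp πm : MB →⋆ₙₐ[ℂ] MD} (hπ : ∀ b ∈ B, πp b - πm b ∈ D) (E₁ E₂ E₃ : MD) {C S : MB} (θ : MB)
    {m : Matrix (Fin 2) (Fin 2) MB} (hC : IsSelfAdjoint C) (hS : IsSelfAdjoint S)
    (hCB : 1 - C ∈ B) (hSB : S ∈ B) (h01 : m 0 1 ∈ B) (h10 : m 1 0 ∈ B) :
    ThetaMap E₁ E₂ !![πp (m 0 0), πp (m 0 1); πp (m 1 0), πm (m 1 1)] + E₃ * πm θ * star E₃ -
      (rotatedSum πp πm E₁ E₂ E₃ C S θ m + rotationCorrection πp πm E₁ E₂ E₃ C S θ m) ∈ D := by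
  set q := D.ringCon.mk'
  have hmem : ∀ x, x ∈ D ↔ q x = 0 := fun x => by
    rw [TwoSidedIdeal.mem_iff, ← map_zero q]
    exact (RingCon.eq _).symm
  have hpm : ∀ b ∈ B, q (πm b) = q (πp b) := fun b hb => by
    have := (hmem _).1 (hπ b hb)
    rw [map_sub, sub_eq_zero] at this
    exact this.symm
  obtain ⟨k, rfl⟩ : ∃ k, C = 1 - k := ⟨1 - C, (sub_sub_cancel _ _).symm⟩
  rw [sub_sub_cancel] at hCB
  have hk : star k = k := by simpa [IsSelfAdjoint] using hC
  have hl : ∀ x, q (πp S) * q (πm x) = q (πp S) * q (πp x) := fun x => by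
    rw [← hpm S hSB, ← map_mul, ← map_mul, hpm _ (B.mul_mem_right _ _ hSB), map_mul, map_mul,
      hpm S hSB]
  have hr : ∀ x, q (πm x) * q (πp S) = q (πp x) * q (πp S) := fun x => by
    rw [← hpm S hSB, ← map_mul, ← map_mul, hpm _ (B.mul_mem_left _ _ hSB), map_mul, map_mul,
      hpm S hSB]
  have h1 : ∀ x r, q (πp S) * (q (πm x) * r) = q (πp S) * (q (πp x) * r) := fun x r => by
    rw [← mul_assoc, hl, mul_assoc]
  have h2 : ∀ x r, q (πm x) * (q (πp S) * r) = q (πp x) * (q (πp S) * r) := fun x r => by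
    rw [← mul_assoc, hr, mul_assoc]
  rw [hmem]
  simp only [ThetaMap, rotatedSum, rotationCorrection, sub_sub_cancel, Matrix.map_apply,
    Matrix.of_apply, Matrix.cons_val', Matrix.cons_val_zero, Matrix.cons_val_one,
    Matrix.cons_val_fin_one, map_add, map_sub, map_mul,
    star_add, star_sub, star_mul, ← map_star, hk, hS.star_eq, hpm _ hCB, hpm _ hSB,
    hpm _ h01, hpm _ h10, mul_sub, sub_mul, mul_one, one_mul]
  simp only [mul_add, add_mul, mul_sub, sub_mul, mul_assoc, h1, h2]
  abel

end RotatedSum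

section RotatedSumAsymptotics

variable {A MB MD : Type*} [NonUnitalCStarAlgebra A] [CStarAlgebra MB] [CStarAlgebra MD]

theorem norm_le_one_of_star_mul_self {M : Type*} [CStarAlgebra M] {V : M} (hV : star V * V = 1) :
    ‖V‖ ≤ 1 := by
  have h := CStarRing.norm_star_mul_self (x := V)
  rw [hV] at h
  have h1 := CStarAlgebra.norm_one_le M
  nlinarith [norm_nonneg V]

theorem norm_mul_mul_star_le {M : Type*} [CStarAlgebra M] {V W : M} (hV : ‖V‖ ≤ 1) (hW : ‖W‖ ≤ 1)
    (x : M) : ‖V * x * star W‖ ≤ ‖x‖ :=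
  calc _ ≤ ‖V‖ * ‖x‖ * ‖star W‖ := norm_mul₃_le
    _ ≤ 1 * ‖x‖ * 1 := by rw [norm_star]; gcongr
    _ = ‖x‖ := by ring

theorem ContinuousOn.matrix_apply {M : Type*} [NormedAddCommGroup M]
    {f : ℝ → Matrix (Fin 2) (Fin 2) M} {s : Set ℝ} (hf : ContinuousOn f s) (i j : Fin 2) :
    ContinuousOn (fun t => f t i j) s :=
  Continuous.comp_continuousOn (g := fun m : Matrix (Fin 2) (Fin 2) M => m i j)
    (continuous_id.matrix_elem i j) hf

theorem NonUnitalStarAlgHom.continuous_of_cstarAlgebra (π : MB →⋆ₙₐ[ℂ] MD) : Continuous π :=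
  AddMonoidHomClass.continuous_of_bound π 1 fun x => by
    simpa using NonUnitalStarAlgHom.norm_apply_le π x

/-- Conjugating an asymptotic homomorphism by a path of isometries. -/
theorem IsAsymptoticHom.conj_isometry {φ : ℝ → A → MB} (hφ : IsAsymptoticHom φ)
    (π : MB →⋆ₙₐ[ℂ] MD) {F : ℝ → MD} (hF : Continuous F) (hFF : ∀ t, star (F t) * F t = 1) :
    IsAsymptoticHom fun t a => F t * π (φ t a) * star (F t) := by
  refine hφ.map (T := fun t x => F t * π x * star (F t)) (K := 1) (fun t x y => ?_)
    (fun t x y => ?_) (fun t x y => ?_) (fun t c x => ?_) (fun t x => ?_) (fun t x => ?_)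
    fun a => ?_
  · calc _ = F t * π x * 1 * π y * star (F t) := by rw [map_mul]; noncomm_ring
      _ = _ := by rw [← hFF t]; noncomm_ring
  · rw [map_add]; noncomm_ring
  · rw [map_sub]; noncomm_ring
  · rw [map_smul, mul_smul_comm, smul_mul_assoc]
  · simp only [map_star, star_mul, star_star, mul_assoc]
  · have hF1 := norm_le_one_of_star_mul_self (hFF t)
    rw [one_mul]
    exact (norm_mul_mul_star_le hF1 hF1 _).trans (NonUnitalStarAlgHom.norm_apply_le π x)
  · exact (hF.continuousOn.mul (π.continuous_of_cstarAlgebra.comp_continuousOn (hφ.1 a))).mul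
      hF.star.continuousOn

theorem IsAsymptoticHom.thetaMap {φ : ℝ → A → Matrix (Fin 2) (Fin 2) MB} (hφ : IsAsymptoticHom φ)
    (π : MB →⋆ₙₐ[ℂ] MD) {F₁ F₂ : ℝ → MD} (hF₁ : Continuous F₁) (hF₂ : Continuous F₂)
    (h₁₁ : ∀ t, star (F₁ t) * F₁ t = 1) (h₂₂ : ∀ t, star (F₂ t) * F₂ t = 1)
    (h₁₂ : ∀ t, star (F₁ t) * F₂ t = 0) :
    IsAsymptoticHom fun t a => ThetaMap (F₁ t) (F₂ t) ((φ t a).map π) := by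
  have h₂₁ : ∀ t, star (F₂ t) * F₁ t = 0 := fun t => by
    simpa using congrArg star (h₁₂ t)
  refine hφ.map (T := fun t x => ThetaMap (F₁ t) (F₂ t) (x.map π)) (K := 4) (fun t x y => ?_)
    (fun t x y => ?_) (fun t x y => ?_) (fun t c x => ?_) (fun t x => ?_) (fun t x => ?_)
    fun a => ?_
  · have g₁₁ : ∀ r, star (F₁ t) * (F₁ t * r) = r := fun r => by rw [← mul_assoc, h₁₁, one_mul]
    have g₂₂ : ∀ r, star (F₂ t) * (F₂ t * r) = r := fun r => by rw [← mul_assoc, h₂₂, one_mul]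
    have g₁₂ : ∀ r, star (F₁ t) * (F₂ t * r) = 0 := fun r => by rw [← mul_assoc, h₁₂, zero_mul]
    have g₂₁ : ∀ r, star (F₂ t) * (F₁ t * r) = 0 := fun r => by rw [← mul_assoc, h₂₁, zero_mul]
    simp only [ThetaMap, Matrix.map_apply, Matrix.mul_apply, Fin.sum_univ_two, map_add, map_mul,
      mul_add, add_mul, mul_assoc, g₁₁, g₂₂, g₁₂, g₂₁, mul_zero, add_zero, zero_add]
    abel
  · simp only [ThetaMap, Matrix.map_apply, Matrix.add_apply, map_add, mul_add, add_mul]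
    abel
  · simp only [ThetaMap, Matrix.map_apply, Matrix.sub_apply, map_sub, mul_sub, sub_mul]
    abel
  · simp only [ThetaMap, Matrix.map_apply, Matrix.smul_apply, map_smul, mul_smul_comm,
      smul_mul_assoc, smul_add]
  · simp only [ThetaMap, Matrix.map_apply, Matrix.star_apply, map_star, star_add, star_mul,
      star_star, mul_assoc]
    abel
  · have hn₁ := norm_le_one_of_star_mul_self (h₁₁ t)
    have hn₂ := norm_le_one_of_star_mul_self (h₂₂ t)
    have hx : ∀ i j, ‖π (x i j)‖ ≤ ‖x‖ := fun i j =>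
      (NonUnitalStarAlgHom.norm_apply_le π _).trans (Matrix.norm_entry_le_entrywise_sup_norm x)
    refine norm_add₄_le.trans ?_
    have i₁ := (norm_mul_mul_star_le hn₁ hn₁ (π (x 0 0))).trans (hx 0 0)
    have i₂ := (norm_mul_mul_star_le hn₁ hn₂ (π (x 0 1))).trans (hx 0 1)
    have i₃ := (norm_mul_mul_star_le hn₂ hn₁ (π (x 1 0))).trans (hx 1 0)
    have i₄ := (norm_mul_mul_star_le hn₂ hn₂ (π (x 1 1))).trans (hx 1 1)
    simp only [Matrix.map_apply]
    linarith
  · have hc : ∀ i j, ContinuousOn (fun t => π (φ t a i j)) (Set.Ici 1) := fun i j =>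
      π.continuous_of_cstarAlgebra.comp_continuousOn ((hφ.1 a).matrix_apply i j)
    have hF₁' := hF₁.continuousOn (s := Set.Ici 1)
    have hF₂' := hF₂.continuousOn (s := Set.Ici 1)
    exact ((((hF₁'.mul (hc 0 0)).mul hF₁'.star).add ((hF₁'.mul (hc 0 1)).mul hF₂'.star)).add
      ((hF₂'.mul (hc 1 0)).mul hF₁'.star)).add ((hF₂'.mul (hc 1 1)).mul hF₂'.star)

variable {θ : ℝ → A → MB} {ψ : ℝ → A → Matrix (Fin 2) (Fin 2) MB} {C S : ℝ → MB}

theorem isAsymptoticHom_add_of_rotation (hθ : IsAsymptoticHom θ) (hψ : IsAsymptoticHom ψ)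
    (πp πm : MB →⋆ₙₐ[ℂ] MD) {E₁ E₂ E₃ : MD}
    (h₁₁ : star E₁ * E₁ = 1) (h₂₂ : star E₂ * E₂ = 1) (h₃₃ : star E₃ * E₃ = 1)
    (h₁₂ : star E₁ * E₂ = 0) (h₁₃ : star E₁ * E₃ = 0) (h₃₂ : star E₃ * E₂ = 0) {c s : ℝ → MD}
    (hc : Continuous c) (hs : Continuous s)
    (hcs : ∀ t, star (c t) = c t ∧ star (s t) = s t ∧ c t * s t = s t * c t ∧
      c t * c t + s t * s t = 1) :
    IsAsymptoticHom fun t a =>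
      (E₁ * c t - E₃ * s t) * πp (θ t a) * star (E₁ * c t - E₃ * s t) +
        ThetaMap (E₁ * s t + E₃ * c t) E₂ ((ψ t a).map πm) := by
  have hswap : ∀ x y : MD, star x * y = 0 → star y * x = 0 := fun x y h => by
    simpa using congrArg star h
  have h₃₁ : star E₃ * E₁ = 0 := hswap _ _ h₁₃
  have g₁₁ : ∀ r, star E₁ * (E₁ * r) = r := fun r => by rw [← mul_assoc, h₁₁, one_mul]
  have g₃₃ : ∀ r, star E₃ * (E₃ * r) = r := fun r => by rw [← mul_assoc, h₃₃, one_mul]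
  have g₁₃ : ∀ r, star E₁ * (E₃ * r) = 0 := fun r => by rw [← mul_assoc, h₁₃, zero_mul]
  have g₃₁ : ∀ r, star E₃ * (E₁ * r) = 0 := fun r => by rw [← mul_assoc, h₃₁, zero_mul]
  have hFF : ∀ t, star (E₁ * c t - E₃ * s t) * (E₁ * c t - E₃ * s t) = 1 := fun t => by
    obtain ⟨h1, h2, -, h4⟩ := hcs t
    simp [h1, h2, mul_sub, sub_mul, mul_assoc, g₁₁, g₃₃, g₁₃, g₃₁, h4]
  have hGG : ∀ t, star (E₁ * s t + E₃ * c t) * (E₁ * s t + E₃ * c t) = 1 := fun t => by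
    obtain ⟨h1, h2, -, h4⟩ := hcs t
    simp [h1, h2, mul_add, add_mul, mul_assoc, g₁₁, g₃₃, g₁₃, g₃₁, add_comm, h4]
  have hGE : ∀ t, star (E₁ * s t + E₃ * c t) * E₂ = 0 := fun t => by
    simp [add_mul, mul_assoc, h₁₂, h₃₂]
  have hFG : ∀ t, star (E₁ * c t - E₃ * s t) * (E₁ * s t + E₃ * c t) = 0 := fun t => by
    obtain ⟨h1, h2, h3, -⟩ := hcs t
    simp [h1, h2, mul_add, sub_mul, mul_assoc, g₁₁, g₃₃, g₁₃, g₃₁, h3]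
  have hFE : ∀ t, star (E₁ * c t - E₃ * s t) * E₂ = 0 := fun t => by
    simp [sub_mul, mul_assoc, h₁₂, h₃₂]
  refine (hθ.conj_isometry πp (F := fun t => E₁ * c t - E₃ * s t) (by fun_prop)
    hFF).add_of_orthogonal (hψ.thetaMap πm (F₁ := fun t => E₁ * s t + E₃ * c t)
      (F₂ := fun _ => E₂) (by fun_prop) continuous_const hGG (fun _ => h₂₂) hGE)
    (fun t a b => ?_) fun t a b => ?_
  · have e₁ : ∀ r, star (E₁ * c t - E₃ * s t) * ((E₁ * s t + E₃ * c t) * r) = 0 := fun r => by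
      rw [← mul_assoc, hFG, zero_mul]
    have e₂ : ∀ r, star (E₁ * c t - E₃ * s t) * (E₂ * r) = 0 := fun r => by
      rw [← mul_assoc, hFE, zero_mul]
    rw [ThetaMap]
    generalize E₁ * c t - E₃ * s t = F at *
    generalize E₁ * s t + E₃ * c t = G at *
    simp only [mul_assoc, mul_add, e₁, e₂, mul_zero, add_zero]
  · have e₁ : ∀ r, star (E₁ * s t + E₃ * c t) * ((E₁ * c t - E₃ * s t) * r) = 0 := fun r => by
      rw [← mul_assoc, hswap _ _ (hFG t), zero_mul]
    have e₂ : ∀ r, star E₂ * ((E₁ * c t - E₃ * s t) * r) = 0 := fun r => by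
      rw [← mul_assoc, hswap _ _ (hFE t), zero_mul]
    rw [ThetaMap]
    generalize E₁ * c t - E₃ * s t = F at *
    generalize E₁ * s t + E₃ * c t = G at *
    simp only [mul_assoc, add_mul, e₁, e₂, mul_zero, add_zero]

theorem isAsymptoticHom_rotatedSum (hθ : IsAsymptoticHom θ) (hψ : IsAsymptoticHom ψ)
    (πp πm : MB →⋆ₙₐ[ℂ] MD) {E₁ E₂ E₃ : MD}
    (h₁₁ : star E₁ * E₁ = 1) (h₂₂ : star E₂ * E₂ = 1) (h₃₃ : star E₃ * E₃ = 1)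
    (h₁₂ : star E₁ * E₂ = 0) (h₁₃ : star E₁ * E₃ = 0) (h₃₂ : star E₃ * E₂ = 0)
    (hC : Continuous C) (hS : Continuous S)
    (hCS : ∀ t, IsSelfAdjoint (C t) ∧ IsSelfAdjoint (S t) ∧ Commute (C t) (S t) ∧
      C t * C t + S t * S t = 1) :
    IsAsymptoticHom fun t a => rotatedSum πp πm E₁ E₂ E₃ (C t) (S t) (θ t a) (ψ t a) := by
  have hc : Continuous fun t => 1 - πm (1 - C t) :=
    continuous_const.sub (πm.continuous_of_cstarAlgebra.comp (continuous_const.sub hC))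
  have hs : Continuous fun t => πm (S t) := πm.continuous_of_cstarAlgebra.comp hS
  have hcs : ∀ t, star (1 - πm (1 - C t)) = 1 - πm (1 - C t) ∧ star (πm (S t)) = πm (S t) ∧
      (1 - πm (1 - C t)) * πm (S t) = πm (S t) * (1 - πm (1 - C t)) ∧
      (1 - πm (1 - C t)) * (1 - πm (1 - C t)) + πm (S t) * πm (S t) = 1 := by
    intro t
    obtain ⟨hC, hS, hcomm, hone⟩ := hCS t
    refine ⟨by simp [← map_star, hC.star_eq], by rw [← map_star, hS.star_eq], ?_, ?_⟩
    · rw [sub_mul, mul_sub, ← map_mul, ← map_mul, sub_mul, mul_sub, hcomm.eq]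
      simp
    · have : (1 - C t) * (1 - C t) + S t * S t = (1 - C t) + (1 - C t) := by
        rw [← sub_eq_zero, ← sub_eq_zero.2 hone]
        noncomm_ring
      have h := congrArg πm this
      rw [map_add, map_add, map_mul, map_mul] at h
      rw [← sub_eq_zero, ← sub_eq_zero.2 h]
      noncomm_ring
  exact isAsymptoticHom_add_of_rotation hθ hψ πp πm h₁₁ h₂₂ h₃₃ h₁₂ h₁₃ h₃₂ hc hs hcs

theorem continuousOn_rotationCorrection (hθ : IsAsymptoticHom θ) (hψ : IsAsymptoticHom ψ)
    (πp πm : MB →⋆ₙₐ[ℂ] MD) (E₁ E₂ E₃ : MD) (hC : Continuous C) (hS : Continuous S) (a : A) :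
    ContinuousOn (fun t => rotationCorrection πp πm E₁ E₂ E₃ (C t) (S t) (θ t a) (ψ t a))
      (Set.Ici 1) := by
  have hθc := hθ.1 a
  have h00 := (hψ.1 a).matrix_apply 0 0
  have h01 := (hψ.1 a).matrix_apply 0 1
  have h10 := (hψ.1 a).matrix_apply 1 0
  have hp := πp.continuous_of_cstarAlgebra
  have hm := πm.continuous_of_cstarAlgebra
  have hCc := hC.continuousOn (s := Set.Ici 1)
  have hSc := hS.continuousOn (s := Set.Ici 1)
  unfold rotationCorrection
  fun_prop

theorem tendsto_rotationCorrection {θ : ℝ → MB} {m : ℝ → Matrix (Fin 2) (Fin 2) MB}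
    (πp πm : MB →⋆ₙₐ[ℂ] MD) (E₁ E₂ E₃ : MD)
    (hCS : ∀ t, Commute (C t) (S t) ∧ C t * C t + S t * S t = 1 ∧ ‖C t‖ ≤ 2 ∧ ‖S t‖ ≤ 2)
    (hCθ : Tendsto (fun t => C t * θ t - θ t * C t) atTop (𝓝 0))
    (hSθ : Tendsto (fun t => S t * θ t - θ t * S t) atTop (𝓝 0))
    (hCb : Tendsto (fun t => C t * (m t 0 0 - θ t)) atTop (𝓝 0))
    (hSb : Tendsto (fun t => (1 - S t) * (m t 0 0 - θ t)) atTop (𝓝 0))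
    (hbC : Tendsto (fun t => (m t 0 0 - θ t) * C t) atTop (𝓝 0))
    (hbS : Tendsto (fun t => (m t 0 0 - θ t) * (1 - S t)) atTop (𝓝 0))
    (hC01 : Tendsto (fun t => C t * m t 0 1) atTop (𝓝 0))
    (hS01 : Tendsto (fun t => (1 - S t) * m t 0 1) atTop (𝓝 0))
    (hC10 : Tendsto (fun t => m t 1 0 * C t) atTop (𝓝 0))
    (hS10 : Tendsto (fun t => m t 1 0 * (1 - S t)) atTop (𝓝 0)) :
    Tendsto (fun t => rotationCorrection πp πm E₁ E₂ E₃ (C t) (S t) (θ t) (m t))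
      atTop (𝓝 0) := by
  have hCbd : IsBoundedUnder (· ≤ ·) atTop (norm ∘ C) := ⟨2, by simp [fun t => (hCS t).2.2.1]⟩
  have hSbd : IsBoundedUnder (· ≤ ·) atTop (norm ∘ S) := ⟨2, by simp [fun t => (hCS t).2.2.2]⟩
  have hCl : ∀ {x : ℝ → MB}, Tendsto x atTop (𝓝 0) → Tendsto (fun t => C t * x t) atTop (𝓝 0) :=
    fun hx => isBoundedUnder_le_mul_tendsto_zero hCbd hx
  have hSl : ∀ {x : ℝ → MB}, Tendsto x atTop (𝓝 0) → Tendsto (fun t => S t * x t) atTop (𝓝 0) :=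
    fun hx => isBoundedUnder_le_mul_tendsto_zero hSbd hx
  have hCr : ∀ {x : ℝ → MB}, Tendsto x atTop (𝓝 0) → Tendsto (fun t => x t * C t) atTop (𝓝 0) :=
    fun hx => hx.zero_mul_isBoundedUnder_le hCbd
  have hSr : ∀ {x : ℝ → MB}, Tendsto x atTop (𝓝 0) → Tendsto (fun t => x t * S t) atTop (𝓝 0) :=
    fun hx => hx.zero_mul_isBoundedUnder_le hSbd
  have h11 : Tendsto (fun t => m t 0 0 - C t * θ t * C t - S t * m t 0 0 * S t) atTop (𝓝 0) := by
    have h := (((hCl hCθ).add (hSl hSθ)).add hSb).add (hSl hbS)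
    simp only [add_zero] at h
    refine h.congr fun t => ?_
    rw [← sub_eq_zero, ← zero_mul (θ t), ← sub_eq_zero.2 (hCS t).2.1]
    noncomm_ring
  have h13 : Tendsto (fun t => C t * θ t * S t - S t * m t 0 0 * C t) atTop (𝓝 0) := by
    have h := ((hSl hCθ).sub (hCl hSθ)).sub (hSl hbC)
    simp only [sub_zero] at h
    refine h.congr fun t => ?_
    rw [← sub_eq_zero, ← zero_mul (θ t), ← sub_eq_zero.2 (hCS t).1.eq.symm]
    noncomm_ring
  have h31 : Tendsto (fun t => S t * θ t * C t - C t * m t 0 0 * S t) atTop (𝓝 0) := by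
    have h := ((hCl hSθ).sub (hSl hCθ)).sub (hSr hCb)
    simp only [sub_zero] at h
    refine h.congr fun t => ?_
    rw [← sub_eq_zero, ← zero_mul (θ t), ← sub_eq_zero.2 (hCS t).1.eq]
    noncomm_ring
  have h33 : Tendsto (fun t => θ t - S t * θ t * S t - C t * m t 0 0 * C t) atTop (𝓝 0) := by
    have h := ((hCl hCθ).add (hSl hSθ)).sub (hCr hCb)
    simp only [sub_zero, add_zero] at h
    refine h.congr fun t => ?_
    rw [← sub_eq_zero, ← zero_mul (θ t), ← sub_eq_zero.2 (hCS t).2.1]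
    noncomm_ring
  have h12 : Tendsto (fun t => m t 0 1 - S t * m t 0 1) atTop (𝓝 0) := by
    simpa only [sub_mul, one_mul] using hS01
  have h21 : Tendsto (fun t => m t 1 0 - m t 1 0 * S t) atTop (𝓝 0) := by
    simpa only [mul_sub, mul_one] using hS10
  have hconj : ∀ (π : MB →⋆ₙₐ[ℂ] MD) (E F : MD) {x : ℝ → MB}, Tendsto x atTop (𝓝 0) →
      Tendsto (fun t => E * π (x t) * star F) atTop (𝓝 0) := fun π E F x hx => by
    have h := (((π.continuous_of_cstarAlgebra.tendsto 0).comp hx).const_mul E).mul_const (star F)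
    simpa using h
  have h := (((((((hconj πp E₁ E₁ h11).add (hconj πm E₁ E₂ h12)).add (hconj πm E₂ E₁ h21)).add
    (hconj πp E₁ E₃ h13)).add (hconj πp E₃ E₁ h31)).sub (hconj πm E₂ E₃ hC10)).sub
    (hconj πm E₃ E₂ hC01)).add (hconj πm E₃ E₃ h33)
  simp only [add_zero, sub_zero] at h
  exact h

end RotatedSumAsymptotics

/-- A path of rotations over the unitization of `B`, asymptotically commuting with `θ` and
asymptotically a quarter turn on the elements of `B` determined by `θ` and `ψ`. -/
theorem IsAsymptoticHom.exists_rotation_path {A MB : Type*} [NonUnitalCStarAlgebra A]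
    [CStarAlgebra MB] [TopologicalSpace.SeparableSpace A] (B : TwoSidedIdeal MB)
    {ψ : ℝ → A → Matrix (Fin 2) (Fin 2) MB} (hψ : IsAsymptoticHom ψ)
    (hψ_equi : Equicontinuous (fun t : Set.Ici (1 : ℝ) => ψ t))
    (hψ_off : ∀ t ∈ Set.Ici (1 : ℝ), ∀ a : A, ψ t a 0 1 ∈ B ∧ ψ t a 1 0 ∈ B)
    {θ : ℝ → A → MB} (hθ : IsAsymptoticHom θ)
    (hθψ : ∀ t ∈ Set.Ici (1 : ℝ), ∀ a : A, ψ t a 0 0 - θ t a ∈ B) :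
    ∃ C S : ℝ → MB, Continuous C ∧ Continuous S ∧
      (∀ t, IsSelfAdjoint (C t) ∧ IsSelfAdjoint (S t) ∧ 1 - C t ∈ B ∧ S t ∈ B ∧
        Commute (C t) (S t) ∧ C t * C t + S t * S t = 1 ∧ ‖C t‖ ≤ 2 ∧ ‖S t‖ ≤ 2) ∧
      ∀ a, (Tendsto (fun t => C t * θ t a - θ t a * C t) atTop (𝓝 0) ∧
          Tendsto (fun t => S t * θ t a - θ t a * S t) atTop (𝓝 0)) ∧
        (Tendsto (fun t => C t * (ψ t a 0 0 - θ t a)) atTop (𝓝 0) ∧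
          Tendsto (fun t => (1 - S t) * (ψ t a 0 0 - θ t a)) atTop (𝓝 0)) ∧
        (Tendsto (fun t => (ψ t a 0 0 - θ t a) * C t) atTop (𝓝 0) ∧
          Tendsto (fun t => (ψ t a 0 0 - θ t a) * (1 - S t)) atTop (𝓝 0)) ∧
        (Tendsto (fun t => C t * ψ t a 0 1) atTop (𝓝 0) ∧
          Tendsto (fun t => (1 - S t) * ψ t a 0 1) atTop (𝓝 0)) ∧
        (Tendsto (fun t => ψ t a 1 0 * C t) atTop (𝓝 0) ∧
          Tendsto (fun t => ψ t a 1 0 * (1 - S t)) atTop (𝓝 0)) := by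
  have hone := CStarAlgebra.norm_one_le MB
  have hmax : ∀ {f : ℝ → MB}, ContinuousOn f (Set.Ici 1) → Continuous fun t => f (max 1 t) :=
    fun hf => hf.comp_continuous (by fun_prop) fun t => le_max_left 1 t
  have hdense := TopologicalSpace.denseRange_denseSeq A
  set u := TopologicalSpace.denseSeq A
  have hψc := fun a i j => (hψ.1 a).matrix_apply i j
  let Y : Fin 3 → ℝ → A → MB :=
    ![fun t a => ψ t a 0 0 - θ t a, fun t a => ψ t a 0 1, fun t a => ψ t a 1 0]
  have hYc : ∀ i a, ContinuousOn (fun t => Y i t a) (Set.Ici 1) := fun i a => by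
    fin_cases i
    exacts [(hψc a 0 0).sub (hθ.1 a), hψc a 0 1, hψc a 1 0]
  have hYB : ∀ i, ∀ t ∈ Set.Ici (1 : ℝ), ∀ a, Y i t a ∈ B := fun i t ht a => by
    fin_cases i
    exacts [hθψ t ht a, (hψ_off t ht a).1, (hψ_off t ht a).2]
  have hYe : ∀ i, AsymptoticallyEquicontinuous (Y i) := fun i => by
    fin_cases i
    exacts [(hψ_equi.asymptoticallyEquicontinuous_apply 0 0).sub hθ.asymptoticallyEquicontinuous,
      hψ_equi.asymptoticallyEquicontinuous_apply 0 1,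
      hψ_equi.asymptoticallyEquicontinuous_apply 1 0]
  obtain ⟨s, hs, hsB, hsθ, hsY⟩ := B.exists_continuous_quasicentral
    (fun n t => θ (max 1 t) (u n)) (fun n => hmax (hθ.1 (u n)))
    (fun i n t => Y i (max 1 t) (u n)) (fun i n => hmax (hYc i (u n)))
    (fun i n t => hYB i _ (le_max_left 1 t) _)
  have hev : ∀ᶠ t : ℝ in atTop, max 1 t = t := by
    filter_upwards [eventually_ge_atTop 1] with t ht using max_eq_right ht
  have hs1 : ∀ t, ‖1 - s t‖ ≤ 2 := fun t =>
    (norm_sub_le _ _).trans (by linarith [(hsB t).2.2])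
  have hθ' : ∀ a, Tendsto (fun t => s t * θ t a - θ t a * s t) atTop (𝓝 0) := by
    refine (hθ.asymptoticallyEquicontinuous.comp_lipschitz (T := fun t x => s t * x - x * s t)
      two_pos fun t x y => ?_).tendsto_zero_of_dense hdense fun n => ?_
    · calc _ = ‖s t * (x - y) - (x - y) * s t‖ := by congr 1; noncomm_ring
        _ ≤ ‖s t‖ * ‖x - y‖ + ‖x - y‖ * ‖s t‖ :=
          (norm_sub_le _ _).trans (add_le_add (norm_mul_le _ _) (norm_mul_le _ _))
        _ ≤ 1 * ‖x - y‖ + ‖x - y‖ * 1 := by gcongr <;> exact (hsB t).2.2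
        _ = 2 * ‖x - y‖ := by ring
    · exact (hsθ n).congr' (by filter_upwards [hev] with t ht; rw [ht])
  have hYl : ∀ i a, Tendsto (fun t => (1 - s t) * Y i t a) atTop (𝓝 0) := fun i => by
    refine ((hYe i).comp_lipschitz (T := fun t x => (1 - s t) * x)
      two_pos fun t x y => ?_).tendsto_zero_of_dense hdense fun n => ?_
    · rw [← mul_sub]
      exact (norm_mul_le _ _).trans (by gcongr; exact hs1 t)
    · exact (hsY i n).1.congr' (by filter_upwards [hev] with t ht; rw [ht])
  have hYr : ∀ i a, Tendsto (fun t => Y i t a * (1 - s t)) atTop (𝓝 0) := fun i => by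
    refine ((hYe i).comp_lipschitz (T := fun t x => x * (1 - s t))
      two_pos fun t x y => ?_).tendsto_zero_of_dense hdense fun n => ?_
    · rw [← sub_mul, mul_comm 2]
      exact (norm_mul_le _ _).trans (by gcongr; exact hs1 t)
    · exact (hsY i n).2.congr' (by filter_upwards [hev] with t ht; rw [ht])
  obtain ⟨C, S, hC, hS, hCS, hcomm, hleft, hright⟩ := B.exists_rotation_path hs hsB
  exact ⟨C, S, hC, hS, hCS, fun a => ⟨hcomm _ (hθ' a), hleft _ (hYl 0 a), hright _ (hYr 0 a),
    hleft _ (hYl 1 a), hright _ (hYr 2 a)⟩⟩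

/-- Lemma `U6`: if the extension determined by `ψ^t_{11}` is asymptotically split (witnessed by
the asymptotic homomorphism `θ`), then `Θ ∘ (π_± × ψ)` becomes, after adding an asymptotic
homomorphism `μ` (via isometries `W₁`, `W₂`), equal modulo `D` to an asymptotic homomorphism
`ν` into `M(D)`.  Here `M(B)` and `M(D)` are modelled as unital C*-algebras `MB`, `MD`
containing `B`, `D` as closed two-sided ideals. -/
theorem statement11 {A MB MD : Type*} [NonUnitalCStarAlgebra A]
    [CStarAlgebra MB] [CStarAlgebra MD]
    (hA_sep : TopologicalSpace.SeparableSpace A)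
    (B : TwoSidedIdeal MB) (hB : IsClosed (B : Set MB))
    (hB_sep : TopologicalSpace.SeparableSpace (B : Set MB))
    (D : TwoSidedIdeal MD) (hD : IsClosed (D : Set MD))
    (πp πm : MB →⋆ₙₐ[ℂ] MD) (hπ : ∀ b ∈ B, πp b - πm b ∈ D)
    (ψ : ℝ → A → Matrix (Fin 2) (Fin 2) MB)
    (hψ : IsAsymptoticHom ψ)
    (hψ_equi : Equicontinuous (fun t : Set.Ici (1 : ℝ) => ψ t))
    (hψ_off : ∀ t ∈ Set.Ici (1 : ℝ), ∀ a : A, ψ t a 0 1 ∈ B ∧ ψ t a 1 0 ∈ B)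
    (hψ_const : ∀ t ∈ Set.Ici (1 : ℝ), ∀ a : A, ∀ i j : Fin 2, ψ t a i j - ψ 1 a i j ∈ B)
    (θ : ℝ → A → MB) (hθ : IsAsymptoticHom θ)
    (hθψ : ∀ t ∈ Set.Ici (1 : ℝ), ∀ a : A, ψ t a 0 0 - θ t a ∈ B)
    (V₁ V₂ : MD) (hV₁ : star V₁ * V₁ = 1) (hV₂ : star V₂ * V₂ = 1)
    (hVV : V₁ * star V₁ + V₂ * star V₂ = 1) :
    ∃ μ ν : ℝ → A → MD, IsAsymptoticHom μ ∧ IsAsymptoticHom ν ∧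
      ∃ W₁ W₂ : MD, star W₁ * W₁ = 1 ∧ star W₂ * W₂ = 1 ∧
        W₁ * star W₁ + W₂ * star W₂ = 1 ∧
        ∀ t ∈ Set.Ici (1 : ℝ), ∀ a : A,
          W₁ * ThetaMap V₁ V₂
              !![πp (ψ t a 0 0), πp (ψ t a 0 1); πp (ψ t a 1 0), πm (ψ t a 1 1)] * star W₁
            + W₂ * μ t a * star W₂ - ν t a ∈ D := by
  have h₁₂ : star V₁ * V₂ = 0 := by
    have h : star V₁ * (V₁ * star V₁ + V₂ * star V₂) * V₂ = star V₁ * V₂ := by rw [hVV, mul_one]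
    have h' : star V₁ * (V₁ * star V₁ + V₂ * star V₂) * V₂ =
        star V₁ * V₁ * (star V₁ * V₂) + star V₁ * V₂ * (star V₂ * V₂) := by noncomm_ring
    rw [h', hV₁, hV₂, one_mul, mul_one] at h
    simpa using h
  have h₂₁ : star V₂ * V₁ = 0 := by simpa using congrArg star h₁₂
  have g₁₁ : ∀ r, star V₁ * (V₁ * r) = r := fun r => by rw [← mul_assoc, hV₁, one_mul]
  have g₂₁ : ∀ r, star V₂ * (V₁ * r) = 0 := fun r => by rw [← mul_assoc, h₂₁, zero_mul]
  obtain ⟨C, S, hC, hS, hCS, hlim⟩ := hψ.exists_rotation_path B hψ_equi hψ_off hθ hθψ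
  have hν := isAsymptoticHom_rotatedSum (E₁ := V₁ * V₁) (E₂ := V₁ * V₂) (E₃ := V₂) hθ hψ πp πm
    (by simp [mul_assoc, g₁₁, hV₁]) (by simp [mul_assoc, g₁₁, hV₂]) hV₂
    (by simp [mul_assoc, g₁₁, h₁₂]) (by simp [mul_assoc, h₁₂]) (by simp [g₂₁]) hC hS
    fun t => ⟨(hCS t).1, (hCS t).2.1, (hCS t).2.2.2.2.1, (hCS t).2.2.2.2.2.1⟩
  refine ⟨fun t a => πm (θ t a), _, ?_, hν.add_of_tendsto_zero
    (e := fun t a =>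
      rotationCorrection πp πm (V₁ * V₁) (V₁ * V₂) V₂ (C t) (S t) (θ t a) (ψ t a))
    (continuousOn_rotationCorrection hθ hψ πp πm _ _ _ hC hS) (fun a => ?_),
    V₁, V₂, hV₁, hV₂, hVV, fun t ht a => ?_⟩
  · simpa using hθ.conj_isometry πm (F := fun _ => 1) continuous_const (by simp)
  · obtain ⟨⟨h1, h2⟩, ⟨h3, h4⟩, ⟨h5, h6⟩, ⟨h7, h8⟩, h9, h10⟩ := hlim a
    exact tendsto_rotationCorrection πp πm _ _ _ (fun t => (hCS t).2.2.2.2)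
      h1 h2 h3 h4 h5 h6 h7 h8 h9 h10
  · rw [mul_thetaMap_mul_star]
    obtain ⟨hCsa, hSsa, hCB, hSB, -⟩ := hCS t
    exact thetaMap_add_sub_rotatedSum_mem hπ _ _ _ _ hCsa hSsa hCB hSB (hψ_off t ht a).1
      (hψ_off t ht a).2
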